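/- arXiv:1903.10361 — 11 statements merged into one kernel-verified Lean document; each statement's English description precedes it below -/
import Mathlib

section
/- The Proportional rule for a good satisfies Fair Share: for every integer n ≥ 2 and every Borel probability measure μ on [0,∞)ⁿ whose coordinate functions X₁,…,Xₙ are integrable with E_μ[X_i] = 1 for every i, one has E_μ[X_i² / (X₁+…+Xₙ)] ≥ 1/n for every i (with the convention that the integrand equals 0 when X₁+…+Xₙ = 0). -/
open MeasureTheory

/-- Tangent-line bound for the perspective of the square: `a² / s ≥ 2ac - c²s`. -/
theorem two_mul_sub_sq_mul_le_sq_div {a s : ℝ} (c : ℝ) (ha : 0 ≤ a) (has : a ≤ s) :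
    2 * c * a - c ^ 2 * s ≤ a ^ 2 / s := by
  rcases (ha.trans has).eq_or_lt with hs | hs
  · obtain rfl : a = 0 := le_antisymm (hs ▸ has) ha
    simp [← hs]
  · rw [le_div_iff₀ hs]
    nlinarith [sq_nonneg (a - c * s)]

/-- The Proportional rule for a good satisfies Fair Share: in every normalized
problem (a Borel probability measure on `[0,∞)ⁿ` with integrable coordinates of
mean 1), every agent's expected utility `E[X_i² / (X₁+…+Xₙ)]` is at least `1/n`
(the integrand is `0` when the sum vanishes, by the convention `a / 0 = 0`). -/
theorem proportional_rule_fair_share_good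
    (n : ℕ) (hn : 2 ≤ n)
    (μ : Measure (Fin n → ℝ)) (hprob : IsProbabilityMeasure μ)
    (hnonneg : ∀ᵐ x ∂μ, ∀ i, 0 ≤ x i)
    (hint : ∀ i : Fin n, Integrable (fun x => x i) μ)
    (hmean : ∀ i : Fin n, ∫ x, x i ∂μ = 1)
    (i : Fin n) :
    (1 : ℝ) / n ≤ ∫ x, (x i) ^ 2 / (∑ j, x j) ∂μ := by
  have hn0 : (n : ℝ) ≠ 0 := by positivity
  have hsum : Integrable (fun x : Fin n → ℝ => ∑ j, x j) μ :=
    integrable_finsetSum _ fun j _ => hint j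
  have hle : ∀ᵐ x ∂μ, 0 ≤ x i ∧ x i ≤ ∑ j, x j := by
    filter_upwards [hnonneg] with x hx
    exact ⟨hx i, Finset.single_le_sum (fun j _ => hx j) (Finset.mem_univ i)⟩
  have hutil : Integrable (fun x : Fin n → ℝ => (x i) ^ 2 / (∑ j, x j)) μ := by
    refine (hint i).mono' (Measurable.aestronglyMeasurable (by fun_prop)) ?_
    filter_upwards [hle] with x ⟨h0, h1⟩
    have hs := h0.trans h1
    rw [Real.norm_of_nonneg (by positivity)]
    exact div_le_of_le_mul₀ hs h0 (by nlinarith)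
  calc (1 : ℝ) / n
      = ∫ x, (2 * (1 / n : ℝ) * x i - (1 / n : ℝ) ^ 2 * ∑ j, x j) ∂μ := by
        rw [integral_sub ((hint i).const_mul _) (hsum.const_mul _), integral_const_mul,
          integral_const_mul, integral_finsetSum _ fun j _ => hint j]
        simp only [hmean, Finset.sum_const, Finset.card_univ, Fintype.card_fin, nsmul_eq_mul]
        field_simp
        norm_num
    _ ≤ ∫ x, (x i) ^ 2 / (∑ j, x j) ∂μ := by
        refine integral_mono_ae (((hint i).const_mul _).sub (hsum.const_mul _)) hutil ?_
        filter_upwards [hle] with x ⟨h0, h1⟩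
        exact two_mul_sub_sq_mul_le_sq_div _ h0 h1
end

section
/- The Proportional rule for a bad satisfies Fair Share: for every integer n ≥ 2 and every Borel probability measure μ on [0,∞)ⁿ whose coordinate functions X₁,…,Xₙ are integrable with E_μ[X_i] = 1 for every i, one has E_μ[1/(1/X₁ + … + 1/Xₙ)] ≤ 1/n (with the convention that the integrand equals 0 when some X_j = 0). -/
open MeasureTheory
open scoped Classical

/-- The inverse of the sum of the inverses of positive reals is at most their sum divided by the
square of their number. -/
theorem inv_sum_inv_le_sum_div_card_sq {ι : Type*} [Fintype ι] [Nonempty ι] {x : ι → ℝ}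
    (hx : ∀ i, 0 < x i) :
    (∑ i, (x i)⁻¹)⁻¹ ≤ (∑ i, x i) / (Fintype.card ι : ℝ) ^ 2 := by
  have hcs := Finset.sum_sq_le_sum_mul_sum_of_sq_le_mul Finset.univ (r := fun _ => (1 : ℝ))
    (fun i _ => (hx i).le) (fun i _ => (inv_pos.2 (hx i)).le)
    (fun i _ => by rw [mul_inv_cancel₀ (hx i).ne', one_pow])
  have hsum : 0 < ∑ i, (x i)⁻¹ :=
    Finset.sum_pos (fun i _ => inv_pos.2 (hx i)) Finset.univ_nonempty
  have hcard : (0 : ℝ) < Fintype.card ι := by exact_mod_cast Fintype.card_pos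
  simp only [Finset.sum_const, Finset.card_univ, nsmul_eq_mul, mul_one] at hcs
  rw [inv_eq_one_div, div_le_div_iff₀ hsum (by positivity), one_mul]
  exact hcs

/-- The Proportional rule for a bad satisfies Fair Share: in every normalized
problem (a Borel probability measure on `[0,∞)ⁿ` with integrable coordinates of
mean 1), every agent's expected disutility `E[1/(1/X₁+…+1/Xₙ)]` is at most `1/n`,
with the convention that the integrand is `0` when some coordinate vanishes. -/
theorem proportional_rule_fair_share_bad
    (n : ℕ) (hn : 2 ≤ n)
    (μ : Measure (Fin n → ℝ)) (hprob : IsProbabilityMeasure μ)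
    (hnonneg : ∀ᵐ x ∂μ, ∀ i, 0 ≤ x i)
    (hint : ∀ i : Fin n, Integrable (fun x => x i) μ)
    (hmean : ∀ i : Fin n, ∫ x, x i ∂μ = 1) :
    ∫ x, (if ∃ j, x j = 0 then 0 else (∑ j, (x j)⁻¹)⁻¹) ∂μ ≤ (1 : ℝ) / n := by
  have : Nonempty (Fin n) := ⟨⟨0, by omega⟩⟩
  calc
    _ ≤ ∫ x, (∑ j, x j) / (n : ℝ) ^ 2 ∂μ := by
      refine integral_mono_of_nonneg ?_
        ((integrable_finsetSum _ fun i _ => hint i).div_const _) ?_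
      · filter_upwards [hnonneg] with x hx
        dsimp only [Pi.zero_apply]
        split_ifs
        · exact le_rfl
        · exact inv_nonneg.2 (Finset.sum_nonneg fun i _ => inv_nonneg.2 (hx i))
      · filter_upwards [hnonneg] with x hx
        split_ifs with h
        · exact div_nonneg (Finset.sum_nonneg fun i _ => hx i) (sq_nonneg _)
        · push Not at h
          simpa using inv_sum_inv_le_sum_div_card_sq fun i => (hx i).lt_of_ne' (h i)
    _ = 1 / n := by
      have hn0 : (n : ℝ) ≠ 0 := by positivity
      rw [integral_div, integral_finsetSum _ fun i _ => hint i]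
      simp only [hmean, Finset.sum_const, Finset.card_univ, Fintype.card_fin, nsmul_eq_mul,
        mul_one]
      field_simp
end

section
/- Characterization of fairness for a good: a symmetric measurable division rule φ : [0,∞)ⁿ → Δ(N) satisfies Fair Share for a good (i.e., E_μ[φ_i(X)·X_i] ≥ 1/n for every normalized problem μ and every i) if and only if there exists a number θ with 0 ≤ θ ≤ 1 such that φ_i(x) ≥ max{1/n + (θ/(n−1))·(1 − x̄/x_i), 0} for every i ∈ N and every x ∈ [0,∞)ⁿ with x_i > 0, where x̄ = (1/n)∑_j x_j. -/
open MeasureTheory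
open scoped BigOperators ENNReal

noncomputable section

namespace PaperFD

/-- A vector of (dis)utilities lies in the positive orthant `[0,∞)ⁿ`. -/
def NonnegVec {n : ℕ} (x : Fin n → ℝ) : Prop := ∀ i, 0 ≤ x i

/-- A division rule: a measurable map from `[0,∞)ⁿ` to the simplex `Δ(N)`. -/
def IsRule {n : ℕ} (φ : (Fin n → ℝ) → (Fin n → ℝ)) : Prop :=
  Measurable φ ∧ ∀ x, NonnegVec x → (∀ i, 0 ≤ φ x i) ∧ ∑ i, φ x i = 1

/-- Symmetry of a rule: permuting the agents permutes their shares.  Here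
`x ∘ σ` is the profile whose `i`-th coordinate is `x (σ i)`. -/
def IsSymmetricRule {n : ℕ} (φ : (Fin n → ℝ) → (Fin n → ℝ)) : Prop :=
  ∀ (σ : Equiv.Perm (Fin n)) (x : Fin n → ℝ), NonnegVec x → ∀ i, φ (x ∘ σ) i = φ x (σ i)

/-- A normalized problem: a Borel probability measure on `[0,∞)ⁿ` whose
coordinate functions are integrable with expectation `1`. -/
def IsNormalizedProblem {n : ℕ} (μ : Measure (Fin n → ℝ)) : Prop :=
  IsProbabilityMeasure μ ∧ (∀ᵐ x ∂μ, NonnegVec x) ∧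
    ∀ i, Integrable (fun x => x i) μ ∧ ∫ x, x i ∂μ = 1

/-- Fair Share for a good: every agent's expected utility is at least `1/n`
in every normalized problem. -/
def FairShareGood {n : ℕ} (φ : (Fin n → ℝ) → (Fin n → ℝ)) : Prop :=
  ∀ μ : Measure (Fin n → ℝ), IsNormalizedProblem μ →
    ∀ i, (1 : ℝ) / n ≤ ∫ x, φ x i * x i ∂μ

/-- Fair Share for a bad: every agent's expected disutility is at most `1/n`
in every normalized problem. -/
def FairShareBad {n : ℕ} (φ : (Fin n → ℝ) → (Fin n → ℝ)) : Prop :=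
  ∀ μ : Measure (Fin n → ℝ), IsNormalizedProblem μ →
    ∀ i, ∫ x, φ x i * x i ∂μ ≤ (1 : ℝ) / n

/-- Domination for goods: `φ` generates at least as much welfare as `ψ` at every
profile, and strictly more at some profile. -/
def DominatesGood {n : ℕ} (φ ψ : (Fin n → ℝ) → (Fin n → ℝ)) : Prop :=
  (∀ x, NonnegVec x → ∑ i, ψ x i * x i ≤ ∑ i, φ x i * x i) ∧
  (∃ x, NonnegVec x ∧ ∑ i, ψ x i * x i < ∑ i, φ x i * x i)

/-- Domination for bads: `φ` generates at most as much cost as `ψ` at every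
profile, and strictly less at some profile. -/
def DominatesBad {n : ℕ} (φ ψ : (Fin n → ℝ) → (Fin n → ℝ)) : Prop :=
  (∀ x, NonnegVec x → ∑ i, φ x i * x i ≤ ∑ i, ψ x i * x i) ∧
  (∃ x, NonnegVec x ∧ ∑ i, φ x i * x i < ∑ i, ψ x i * x i)

/-- The Top-Heavy rule `φ^θ` for a good: agents outside the argmax set `τ(x)`
receive `max{1/n + (θ/(n−1))(1 − x̄/x_i), 0}` (which is `0` when `x_i = 0`),
and the agents with the largest utility split the remaining probability
equally. -/
def topHeavy (n : ℕ) (θ : ℝ) (x : Fin n → ℝ) : Fin n → ℝ := fun i =>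
  let lowShare : Fin n → ℝ := fun j =>
    if x j = 0 then 0
    else max ((1 : ℝ) / n + θ / ((n : ℝ) - 1) * (1 - ((∑ k, x k) / n) / x j)) 0
  let τ : Finset (Fin n) := Finset.univ.filter fun j => ∀ k, x k ≤ x j
  if i ∈ τ then (1 - ∑ j ∈ τᶜ, lowShare j) / (τ.card : ℝ)
  else lowShare i

/-- The Proportional rule for a good. -/
def propGood (n : ℕ) (x : Fin n → ℝ) : Fin n → ℝ := fun i =>
  if (∑ j, x j) = 0 then 1 / n else x i / ∑ j, x j

/-- The Bottom-Heavy rule `φ¹` for a bad.  When all coordinates are positive,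
`t̃` is the largest `t ∈ {0,…,n}` such that
`∑_{i : x_i ≤ x^{(t)}} (∑_{j≠i} x_j)/(n(n−1)x_i) ≤ 1`; the agents with
`x_i ≤ x^{(t̃)}` receive that bound, the agents at the next order statistic
split the remainder equally, and all others get `0`.  When some coordinate is
zero, the agents with zero disutility split the bad equally. -/
def bottomHeavy (n : ℕ) (x : Fin n → ℝ) : Fin n → ℝ := fun i =>
  if ∀ j, 0 < x j then
    let w : Fin n → ℝ := fun j =>
      (∑ k ∈ Finset.univ.erase j, x k) / ((n : ℝ) * ((n : ℝ) - 1) * x j)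
    let sorted : Fin n → ℝ := fun k => x (Tuple.sort x k)
    let low : ℕ → Finset (Fin n) := fun t =>
      Finset.univ.filter fun j => ∃ k : Fin n, (k : ℕ) < t ∧ x j ≤ sorted k
    let tt : ℕ := Nat.findGreatest (fun t => ∑ j ∈ low t, w j ≤ 1) n
    if i ∈ low tt then w i
    else if htt : tt < n then
      if x i = sorted ⟨tt, htt⟩ then
        (1 - ∑ j ∈ low tt, w j) /
          ((Finset.univ.filter fun j => x j = sorted ⟨tt, htt⟩).card : ℝ)
      else 0
    else 0
  else if x i = 0 then ((Finset.univ.filter fun j : Fin n => x j = 0).card : ℝ)⁻¹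
  else 0


/-- The measure with mass `w k` at the point `X k`. -/
def finiteMixture {n : ℕ} {K : Type} [Fintype K] (w : K → ℝ) (X : K → Fin n → ℝ) :
    Measure (Fin n → ℝ) :=
  ∑ k, ENNReal.ofReal (w k) • Measure.dirac (X k)

theorem integrable_finiteMixture {n : ℕ} {K : Type} [Fintype K] (w : K → ℝ)
    (X : K → Fin n → ℝ) (f : (Fin n → ℝ) → ℝ) : Integrable f (finiteMixture w X) :=
  integrable_finsetSum_measure.2 fun _ _ =>
    (integrable_dirac enorm_lt_top).smul_measure ENNReal.ofReal_ne_top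

theorem integral_finiteMixture {n : ℕ} {K : Type} [Fintype K] (w : K → ℝ)
    (hw : ∀ k, 0 ≤ w k) (X : K → Fin n → ℝ) (f : (Fin n → ℝ) → ℝ) :
    ∫ x, f x ∂(finiteMixture w X) = ∑ k, w k * f (X k) := by
  rw [finiteMixture, integral_finsetSum_measure fun _ _ =>
    (integrable_dirac enorm_lt_top).smul_measure ENNReal.ofReal_ne_top]
  refine Finset.sum_congr rfl fun k _ => ?_
  rw [integral_smul_measure, integral_dirac, ENNReal.toReal_ofReal (hw k), smul_eq_mul]

theorem isNormalizedProblem_finiteMixture {n : ℕ} {K : Type} [Fintype K] (w : K → ℝ)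
    (hw : ∀ k, 0 ≤ w k) (hw1 : ∑ k, w k = 1) (X : K → Fin n → ℝ)
    (hX : ∀ k, NonnegVec (X k)) (hm : ∀ i, ∑ k, w k * X k i = 1) :
    IsNormalizedProblem (finiteMixture w X) := by
  refine ⟨⟨?_⟩, ?_, fun i => ⟨integrable_finiteMixture w X _, ?_⟩⟩
  · simp only [finiteMixture, Measure.coe_finsetSum, Finset.sum_apply, Measure.smul_apply,
      measure_univ, smul_eq_mul, mul_one]
    rw [← ENNReal.ofReal_sum_of_nonneg fun k _ => hw k, hw1, ENNReal.ofReal_one]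
  · rw [ae_iff, finiteMixture, Measure.coe_finsetSum, Finset.sum_apply]
    refine Finset.sum_eq_zero fun k _ => ?_
    rw [Measure.smul_apply, Measure.dirac_apply]
    simp [hX k]
  · rw [integral_finiteMixture w hw, hm i]

/-- On the diagonal a symmetric rule gives everyone `1 / n`. -/
theorem IsSymmetricRule.apply_const {n : ℕ} (hn : 0 < n) {φ : (Fin n → ℝ) → (Fin n → ℝ)}
    (hrule : IsRule φ) (hsym : IsSymmetricRule φ) {t : ℝ} (ht : 0 ≤ t) (i : Fin n) :
    φ (fun _ => t) i = 1 / n := by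
  have hx : NonnegVec (fun _ : Fin n => t) := fun _ => ht
  have heq : ∀ j, φ (fun _ => t) j = φ (fun _ => t) i := fun j => by
    have h := hsym (Equiv.swap i j) _ hx i
    rw [Equiv.swap_apply_left] at h
    exact h.symm
  have hsum := (hrule.2 _ hx).2
  rw [Finset.sum_congr rfl fun j _ => heq j] at hsum
  simp only [Finset.sum_const, Finset.card_univ, Fintype.card_fin, nsmul_eq_mul] at hsum
  have : (0 : ℝ) < n := by exact_mod_cast hn
  field_simp
  linarith

/-- Fair Share for finite lotteries in which all agents have the same mean `m`, not
necessarily equal to `1`. -/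
theorem FairShareGood.finite_lottery {n : ℕ} (hn : 0 < n) {φ : (Fin n → ℝ) → (Fin n → ℝ)}
    (hrule : IsRule φ) (hsym : IsSymmetricRule φ) (hF : FairShareGood φ)
    {K : Type} [Fintype K] (w : K → ℝ) (hw : ∀ k, 0 ≤ w k) (hw1 : ∑ k, w k = 1)
    (X : K → Fin n → ℝ) (hX : ∀ k, NonnegVec (X k)) (m : ℝ)
    (hm : ∀ i, ∑ k, w k * X k i = m) (i : Fin n) :
    m / n ≤ ∑ k, w k * (φ (X k) i * X k i) := by
  have hm0 : 0 ≤ m := by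
    rw [← hm i]
    exact Finset.sum_nonneg fun k _ => mul_nonneg (hw k) (hX k i)
  rcases hm0.eq_or_lt with h0 | hpos
  · rw [← h0, zero_div]
    exact Finset.sum_nonneg fun k _ =>
      mul_nonneg (hw k) (mul_nonneg ((hrule.2 _ (hX k)).1 i) (hX k i))
  have hnpos : (0 : ℝ) < n := by exact_mod_cast hn
  let w' : Option K → ℝ := fun o => o.elim (m / (1 + m)) fun k => w k / (1 + m)
  let X' : Option K → Fin n → ℝ := fun o => o.elim (fun _ => 1 / m) X
  have hscale : ∀ f : K → ℝ, ∑ k, w k / (1 + m) * f k = (∑ k, w k * f k) / (1 + m) := by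
    intro f
    rw [Finset.sum_div]
    exact Finset.sum_congr rfl fun k _ => by ring
  have hw' : ∀ o, 0 ≤ w' o := by
    rintro (_ | k)
    · change 0 ≤ m / (1 + m); positivity
    · exact div_nonneg (hw k) (by linarith)
  have hprob : IsNormalizedProblem (finiteMixture w' X') := by
    refine isNormalizedProblem_finiteMixture w' hw' ?_ X' ?_ ?_
    · rw [Fintype.sum_option]
      change m / (1 + m) + ∑ k, w k / (1 + m) = 1
      rw [← Finset.sum_div, hw1]
      field_simp
      ring
    · rintro (_ | k)
      · exact fun _ => by change 0 ≤ 1 / m; positivity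
      · exact hX k
    · intro j
      rw [Fintype.sum_option]
      change m / (1 + m) * (1 / m) + ∑ k, w k / (1 + m) * X k j = 1
      rw [hscale, hm j]
      field_simp
  have h := hF _ hprob i
  rw [integral_finiteMixture w' hw' X' fun x => φ x i * x i, Fintype.sum_option] at h
  change 1 / (n : ℝ) ≤ m / (1 + m) * (φ (fun _ => 1 / m) i * (1 / m)) +
    ∑ k, w k / (1 + m) * (φ (X k) i * X k i) at h
  rw [hscale, hsym.apply_const hn hrule (by positivity)] at h
  have hid : m / (1 + m) * (1 / (n : ℝ) * (1 / m)) = 1 / n / (1 + m) := by field_simp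
  rw [hid, ← add_div, le_div_iff₀ (by linarith)] at h
  have : m / (n : ℝ) = 1 / n * (1 + m) - 1 / n := by ring
  linarith

/-- Summing a coordinate `j ≠ i` of `x` over all permutations that fix `i`. -/
theorem sum_perm_fixing_apply {n : ℕ} (x : Fin n → ℝ) {i j : Fin n} (hj : j ≠ i) :
    ((n : ℝ) - 1) * ∑ σ : {σ : Equiv.Perm (Fin n) // σ i = i}, x (σ.1 j) =
      (Fintype.card {σ : Equiv.Perm (Fin n) // σ i = i} : ℝ) * (∑ k, x k - x i) := by
  have hindep : ∀ k ∈ Finset.univ.erase i,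
      ∑ σ : {σ : Equiv.Perm (Fin n) // σ i = i}, x (σ.1 k) =
        ∑ σ : {σ : Equiv.Perm (Fin n) // σ i = i}, x (σ.1 j) := by
    intro k hk
    have hki : k ≠ i := Finset.ne_of_mem_erase hk
    have hfix : Equiv.swap j k i = i := Equiv.swap_apply_of_ne_of_ne hj.symm hki.symm
    refine Fintype.sum_equiv
      (Equiv.subtypeEquiv (Equiv.mulRight (Equiv.swap j k)) fun σ => ?_) _ _ fun σ => ?_
    · simp [Equiv.Perm.mul_apply, hfix]
    · simp [Equiv.subtypeEquiv_apply, Equiv.Perm.mul_apply]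
  have hrow : ∀ σ : {σ : Equiv.Perm (Fin n) // σ i = i},
      ∑ k ∈ Finset.univ.erase i, x (σ.1 k) = ∑ k, x k - x i := by
    intro σ
    rw [Finset.sum_erase_eq_sub (Finset.mem_univ i), Equiv.sum_comp σ.1 x, σ.2]
  have hcard : (((Finset.univ : Finset (Fin n)).erase i).card : ℝ) = (n : ℝ) - 1 := by
    rw [Finset.card_erase_of_mem (Finset.mem_univ i), Finset.card_univ, Fintype.card_fin,
      Nat.cast_sub (Nat.one_le_of_lt i.2), Nat.cast_one]
  have hsum := Finset.sum_congr rfl hindep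
  rw [Finset.sum_comm, Finset.sum_congr rfl fun σ _ => hrow σ] at hsum
  simp only [Finset.sum_const, nsmul_eq_mul, hcard, Finset.card_univ] at hsum
  exact hsum.symm

/-- Agent `i`'s surplus over the equal share, averaged over two profiles at which agent `i`'s
deviation from the mean averages to zero, is nonnegative. -/
theorem FairShareGood.two_point {n : ℕ} (hn : 2 ≤ n) {φ : (Fin n → ℝ) → (Fin n → ℝ)}
    (hrule : IsRule φ) (hsym : IsSymmetricRule φ) (hF : FairShareGood φ) (i : Fin n)
    {x y : Fin n → ℝ} (hx : NonnegVec x) (hy : NonnegVec y) {a b : ℝ}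
    (ha : 0 ≤ a) (hb : 0 ≤ b) (hab : 0 < a + b)
    (hd : a * (n * x i - ∑ k, x k) + b * (n * y i - ∑ k, y k) = 0) :
    0 ≤ a * (φ x i * x i - x i / n) + b * (φ y i * y i - y i / n) := by
  have hn1 : (0 : ℝ) < (n : ℝ) - 1 := by
    have : (2 : ℝ) ≤ n := by exact_mod_cast hn
    linarith
  let P := {σ : Equiv.Perm (Fin n) // σ i = i}
  let c : ℝ := Fintype.card P
  have : Nonempty P := ⟨⟨1, rfl⟩⟩
  have hc : 0 < c := Nat.cast_pos.2 Fintype.card_pos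
  let w : P ⊕ P → ℝ := Sum.elim (fun _ => a / ((a + b) * c)) fun _ => b / ((a + b) * c)
  let X : P ⊕ P → Fin n → ℝ := Sum.elim (fun σ => x ∘ σ.1) fun σ => y ∘ σ.1
  have hfix : ∀ (z : Fin n → ℝ), ∑ _σ : P, z i = c * z i := fun z => by simp [c]
  have hsurplus : ∀ (z : Fin n → ℝ), NonnegVec z →
      ∑ σ : P, φ (z ∘ σ.1) i * (z ∘ σ.1) i = c * (φ z i * z i) := by
    intro z hz
    rw [Finset.sum_congr rfl fun σ _ => by
      rw [hsym σ.1 z hz i, Function.comp_apply, σ.2]]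
    simp [c]
  have h := hF.finite_lottery (by omega) hrule hsym w ?_ ?_ X ?_
    ((a * x i + b * y i) / (a + b)) ?_ i
  · rw [Fintype.sum_sum_type] at h
    simp only [w, X, Sum.elim_inl, Sum.elim_inr] at h
    rw [← Finset.mul_sum, ← Finset.mul_sum, hsurplus x hx, hsurplus y hy] at h
    have hr : a / ((a + b) * c) * (c * (φ x i * x i)) + b / ((a + b) * c) * (c * (φ y i * y i))
        = (a * (φ x i * x i) + b * (φ y i * y i)) / (a + b) := by
      field_simp
    rw [hr, div_right_comm, div_le_div_iff_of_pos_right hab] at h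
    have hs : (a * x i + b * y i) / (n : ℝ) = a * (x i / n) + b * (y i / n) := by ring
    linarith
  · rintro (σ | σ)
    · change 0 ≤ a / ((a + b) * c); positivity
    · change 0 ≤ b / ((a + b) * c); positivity
  · rw [Fintype.sum_sum_type]
    simp only [w, Sum.elim_inl, Sum.elim_inr, Finset.sum_const, Finset.card_univ, nsmul_eq_mul]
    change c * _ + c * _ = 1
    field_simp
  · rintro (σ | σ)
    · exact fun j => hx _
    · exact fun j => hy _
  · intro j
    rw [Fintype.sum_sum_type]
    simp only [w, X, Sum.elim_inl, Sum.elim_inr, Function.comp_apply]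
    rw [← Finset.mul_sum, ← Finset.mul_sum]
    by_cases hj : j = i
    · subst hj
      have hz : ∀ (z : Fin n → ℝ), ∑ σ : P, z (σ.1 j) = c * z j := fun z => by
        rw [← hfix z]
        exact Finset.sum_congr rfl fun σ _ => by rw [σ.2]
      rw [hz, hz]
      field_simp
    · have hz : ∀ (z : Fin n → ℝ),
          ∑ σ : P, z (σ.1 j) = c * (∑ k, z k - z i) / ((n : ℝ) - 1) := fun z => by
        rw [eq_div_iff hn1.ne', mul_comm]
        exact sum_perm_fixing_apply z hj
      rw [hz, hz]
      field_simp
      linarith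

/-- A slope separating the profiles where agent `i` is above the mean from those where it is
below. -/
theorem FairShareGood.exists_slope {n : ℕ} (hn : 2 ≤ n) {φ : (Fin n → ℝ) → (Fin n → ℝ)}
    (hrule : IsRule φ) (hsym : IsSymmetricRule φ) (hF : FairShareGood φ) (i : Fin n) :
    ∃ s : ℝ, 0 ≤ s ∧ ∀ x, NonnegVec x →
      s * (n * x i - ∑ k, x k) ≤ φ x i * x i - x i / n := by
  have hn2 : (2 : ℝ) ≤ n := by exact_mod_cast hn
  let d : (Fin n → ℝ) → ℝ := fun x => n * x i - ∑ k, x k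
  let g : (Fin n → ℝ) → ℝ := fun x => φ x i * x i - x i / n
  let S : Set ℝ := {r | ∃ y, NonnegVec y ∧ d y < 0 ∧ r = g y / d y}
  have hle : ∀ x, NonnegVec x → 0 < d x → ∀ r ∈ S, r ≤ g x / d x := by
    rintro x hx hdx r ⟨y, hy, hdy, rfl⟩
    have h : 0 ≤ -d y * g x + d x * g y :=
      hF.two_point hn hrule hsym i hx hy (by linarith) hdx.le (by linarith)
        (show -d y * d x + d x * d y = 0 by ring)
    rw [le_div_iff₀ hdx, div_mul_eq_mul_div, div_le_iff_of_neg hdy]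
    linarith
  have hsingle : ∀ j : Fin n, NonnegVec (Pi.single j (1 : ℝ)) := fun j k => by
    rw [Pi.single_apply]
    split_ifs <;> norm_num
  have hbdd : BddAbove S := by
    refine ⟨_, hle (Pi.single i 1) (hsingle i) ?_⟩
    simp only [d, Pi.single_eq_same, Finset.sum_pi_single', Finset.mem_univ, if_true]
    linarith
  obtain ⟨j, hj⟩ : ∃ j : Fin n, j ≠ i :=
    have : Nontrivial (Fin n) := Fin.nontrivial_iff_two_le.2 hn
    exists_ne i
  have hzero : (0 : ℝ) ∈ S :=
    ⟨Pi.single j 1, hsingle j, by simp [d, hj.symm], by simp [g, hj.symm]⟩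
  refine ⟨sSup S, le_csSup hbdd hzero, fun x hx => ?_⟩
  change sSup S * d x ≤ g x
  rcases lt_trichotomy (d x) 0 with hneg | h0 | hpos
  · rw [← div_le_iff_of_neg hneg]
    exact le_csSup hbdd ⟨x, hx, hneg, rfl⟩
  · have h : 0 ≤ (1 : ℝ) * g x + 0 * g x :=
      hF.two_point hn hrule hsym i hx hx zero_le_one le_rfl (by norm_num)
        (show 1 * d x + 0 * d x = 0 by rw [h0]; ring)
    rw [h0, mul_zero]
    linarith
  · rw [← le_div_iff₀ hpos]
    exact csSup_le ⟨0, hzero⟩ (hle x hx hpos)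

/-- When everyone but `j` has utility `1` and `j` has utility `0`, an agent other than `j` gets
at most `1 / (n - 1)`. -/
theorem IsSymmetricRule.mul_apply_le_one {n : ℕ} {φ : (Fin n → ℝ) → (Fin n → ℝ)}
    (hrule : IsRule φ) (hsym : IsSymmetricRule φ) {i j : Fin n} (hj : j ≠ i) :
    ((n : ℝ) - 1) * φ (1 - Pi.single j 1) i ≤ 1 := by
  set x : Fin n → ℝ := 1 - Pi.single j 1 with hxdef
  have hx : NonnegVec x := fun k => by
    rw [hxdef, Pi.sub_apply, Pi.single_apply]
    split_ifs <;> norm_num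
  have heq : ∀ k ∈ Finset.univ.erase j, φ x k = φ x i := by
    intro k hk
    have hkj : k ≠ j := Finset.ne_of_mem_erase hk
    have h := hsym (Equiv.swap i k) x hx i
    have hinv : x ∘ Equiv.swap i k = x := by
      funext l
      rw [Function.comp_apply, Equiv.swap_apply_def]
      split_ifs with h1 h2
      · simp [hxdef, h1, hkj, hj.symm]
      · simp [hxdef, h2, hkj, hj.symm]
      · rfl
    rw [hinv, Equiv.swap_apply_left] at h
    exact h.symm
  have hsum := (hrule.2 x hx).2
  rw [← Finset.add_sum_erase _ _ (Finset.mem_univ j), Finset.sum_congr rfl heq,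
    Finset.sum_const, Finset.card_erase_of_mem (Finset.mem_univ j), Finset.card_univ,
    Fintype.card_fin, nsmul_eq_mul, Nat.cast_sub (Nat.one_le_of_lt i.2), Nat.cast_one] at hsum
  linarith [(hrule.2 x hx).1 j]

/-- A pointwise linear lower bound on utilities implies Fair Share. -/
theorem fairShareGood_of_linear_bound {n : ℕ} (hn : 0 < n) {φ : (Fin n → ℝ) → (Fin n → ℝ)}
    (hrule : IsRule φ) (s : ℝ)
    (h : ∀ x, NonnegVec x → ∀ i, x i / n + s * (x i - (∑ j, x j) / n) ≤ φ x i * x i) :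
    FairShareGood φ := by
  rintro μ ⟨hprob, hnonneg, hint⟩ i
  have hnpos : (0 : ℝ) < n := by exact_mod_cast hn
  have hsumInt : Integrable (fun x : Fin n → ℝ => ∑ j, x j) μ :=
    integrable_finsetSum _ fun j _ => (hint j).1
  have hdev : Integrable (fun x : Fin n → ℝ => s * (x i - (∑ j, x j) / n)) μ :=
    (((hint i).1.sub (hsumInt.div_const _)).const_mul s)
  have hlow : Integrable (fun x : Fin n → ℝ => x i / n + s * (x i - (∑ j, x j) / n)) μ :=
    ((hint i).1.div_const _).add hdev
  have hutil : Integrable (fun x : Fin n → ℝ => φ x i * x i) μ := by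
    refine (hint i).1.mono ?_ ?_
    · exact (((measurable_pi_apply i).comp hrule.1).mul
        (measurable_pi_apply i)).aestronglyMeasurable
    · filter_upwards [hnonneg] with x hx
      have h0 := (hrule.2 x hx).1
      have h1 : φ x i ≤ 1 := by
        rw [← (hrule.2 x hx).2]
        exact Finset.single_le_sum (fun j _ => h0 j) (Finset.mem_univ i)
      rw [norm_mul, Real.norm_of_nonneg (h0 i)]
      exact mul_le_of_le_one_left (norm_nonneg _) h1
  have hval : ∫ x, (x i / n + s * (x i - (∑ j, x j) / n)) ∂μ = 1 / n := by
    rw [integral_add ((hint i).1.div_const _) hdev, integral_div, integral_const_mul,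
      integral_sub (hint i).1 (hsumInt.div_const _), integral_div,
      integral_finsetSum _ fun j _ => (hint j).1, (hint i).2,
      Finset.sum_congr rfl fun j _ => (hint j).2]
    simp [hnpos.ne']
  rw [← hval]
  refine integral_mono_ae hlow hutil ?_
  filter_upwards [hnonneg] with x hx using h x hx i

/-- Characterization of fairness for a good (Proposition 2): a symmetric
measurable division rule `φ` satisfies Fair Share for a good iff there is a
`θ ∈ [0,1]` with `φ_i(x) ≥ max{1/n + (θ/(n−1))(1 − x̄/x_i), 0}` for every agent
`i` and every profile `x ∈ [0,∞)ⁿ` with `x_i > 0`, where `x̄ = (∑_j x_j)/n`. -/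
theorem fair_share_characterization_good
    (n : ℕ) (hn : 2 ≤ n) (φ : (Fin n → ℝ) → (Fin n → ℝ))
    (hrule : IsRule φ) (hsym : IsSymmetricRule φ) :
    FairShareGood φ ↔
      ∃ θ : ℝ, 0 ≤ θ ∧ θ ≤ 1 ∧
        ∀ x : Fin n → ℝ, NonnegVec x → ∀ i, 0 < x i →
          max ((1 : ℝ) / n + θ / ((n : ℝ) - 1) * (1 - ((∑ j, x j) / n) / x i)) 0
            ≤ φ x i := by
  have hn2 : (2 : ℝ) ≤ n := by exact_mod_cast hn
  have hn1 : (0 : ℝ) < (n : ℝ) - 1 := by linarith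
  have hn0 : (0 : ℝ) < n := by linarith
  constructor
  · intro hF
    let i₀ : Fin n := ⟨0, by omega⟩
    obtain ⟨s, hs0, hs⟩ := hF.exists_slope hn hrule hsym i₀
    have hsall : ∀ x, NonnegVec x → ∀ i,
        s * (n * x i - ∑ k, x k) ≤ φ x i * x i - x i / n := by
      intro x hx i
      have h := hs (x ∘ Equiv.swap i₀ i) fun k => hx _
      have hsum : ∑ k, (x ∘ Equiv.swap i₀ i) k = ∑ k, x k := Equiv.sum_comp _ x
      rwa [hsum, hsym _ x hx, Function.comp_apply, Equiv.swap_apply_left] at h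
    refine ⟨n * (n - 1) * s, by positivity, ?_, fun x hx i hi => ?_⟩
    · let i₁ : Fin n := ⟨1, by omega⟩
      have hne : i₁ ≠ i₀ := by simp [i₀, i₁]
      have hle := hsym.mul_apply_le_one hrule hne
      have h := hs (1 - Pi.single i₁ 1) fun k => by
        rw [Pi.sub_apply, Pi.single_apply]
        split_ifs <;> norm_num
      have hsum : ∑ k, (1 - Pi.single i₁ 1 : Fin n → ℝ) k = (n : ℝ) - 1 := by
        simp [Finset.sum_sub_distrib]
      have hval : (1 - Pi.single i₁ 1 : Fin n → ℝ) i₀ = 1 := by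
        simp [hne.symm]
      rw [hsum, hval] at h
      have h' : s + 1 / n ≤ φ (1 - Pi.single i₁ 1) i₀ := by linarith
      have h2 := (mul_le_mul_of_nonneg_left h' hn1.le).trans hle
      have h3 := mul_le_mul_of_nonneg_left h2 hn0.le
      have h4 : (n : ℝ) * ((n - 1) * (s + 1 / n)) = n * (n - 1) * s + (n - 1) := by
        field_simp
      linarith
    · refine max_le ?_ ((hrule.2 x hx).1 i)
      rw [← mul_le_mul_iff_left₀ hi]
      have hid : (1 / (n : ℝ) + n * (n - 1) * s / (n - 1) * (1 - (∑ j, x j) / n / x i)) * x i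
          = x i / n + s * (n * x i - ∑ k, x k) := by
        field_simp
      rw [hid]
      linarith [hsall x hx i]
  · rintro ⟨θ, hθ0, -, h⟩
    refine fairShareGood_of_linear_bound (by omega) hrule (θ / ((n : ℝ) - 1)) fun x hx i => ?_
    rcases (hx i).eq_or_lt with h0 | hpos
    · have hsum : 0 ≤ ∑ j, x j := Finset.sum_nonneg fun j _ => hx j
      rw [← h0, zero_div, mul_zero, zero_add, zero_sub]
      exact mul_nonpos_of_nonneg_of_nonpos (by positivity) (neg_nonpos.2 (by positivity))
    · have h1 := mul_le_mul_of_nonneg_right ((le_max_left _ _).trans (h x hx i hpos)) hpos.le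
      refine le_trans (le_of_eq ?_) h1
      field_simp

end PaperFD
end
end

section
/- For n = 2, the Top-Heavy rule φ¹ dominates every other Top-Heavy rule: for every θ ∈ (0,1), one has φ¹₁(x)·x₁ + φ¹₂(x)·x₂ ≥ φ^θ₁(x)·x₁ + φ^θ₂(x)·x₂ for every x ∈ [0,∞)², with strict inequality for some x (in particular, strict whenever 1/2 < x₁/x₂ < 1 or 1 < x₁/x₂ < 2). -/
open MeasureTheory
open scoped BigOperators ENNReal

noncomputable section

namespace PaperFD

/-- The share given by the two-agent Top-Heavy rule to the agent with the smaller utility `a`,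
when the other agent has utility `b`. -/
def lowShareTwo (θ a b : ℝ) : ℝ :=
  if a = 0 then 0 else max (1 / 2 + θ * (1 - (a + b) / 2 / a)) 0

lemma sum_topHeavy_two_of_lt (θ : ℝ) {x : Fin 2 → ℝ} (h : x 0 < x 1) :
    ∑ i, topHeavy 2 θ x i * x i = x 1 - lowShareTwo θ (x 0) (x 1) * (x 1 - x 0) := by
  have hτ : (Finset.univ.filter fun j => ∀ k, x k ≤ x j) = {(1 : Fin 2)} := by
    ext j
    fin_cases j <;> simp [Fin.forall_fin_two, h, h.le]
  have hc : ({(1 : Fin 2)} : Finset (Fin 2))ᶜ = {0} := by decide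
  simp only [topHeavy, hτ, hc, lowShareTwo, Fin.sum_univ_two]
  norm_num
  split_ifs <;> ring

lemma sum_topHeavy_two_of_gt (θ : ℝ) {x : Fin 2 → ℝ} (h : x 1 < x 0) :
    ∑ i, topHeavy 2 θ x i * x i = x 0 - lowShareTwo θ (x 1) (x 0) * (x 0 - x 1) := by
  have hτ : (Finset.univ.filter fun j => ∀ k, x k ≤ x j) = {(0 : Fin 2)} := by
    ext j
    fin_cases j <;> simp [Fin.forall_fin_two, h, h.le]
  have hc : ({(0 : Fin 2)} : Finset (Fin 2))ᶜ = {1} := by decide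
  simp only [topHeavy, hτ, hc, lowShareTwo, Fin.sum_univ_two, add_comm (x 1) (x 0)]
  norm_num
  split_ifs <;> ring

lemma sum_topHeavy_two_of_eq (θ : ℝ) {x : Fin 2 → ℝ} (h : x 0 = x 1) :
    ∑ i, topHeavy 2 θ x i * x i = x 0 := by
  have hτ : (Finset.univ.filter fun j => ∀ k, x k ≤ x j) = (Finset.univ : Finset (Fin 2)) := by
    ext j
    fin_cases j <;> simp [Fin.forall_fin_two, h]
  simp only [topHeavy, hτ, Fin.sum_univ_two, h]
  norm_num
  ring

lemma one_sub_mean_div_neg {a b : ℝ} (ha : 0 < a) (hab : a < b) :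
    1 - (a + b) / 2 / a < 0 := by
  rw [sub_neg, one_lt_div ha]
  linarith

lemma lowShareTwo_one_le {θ a b : ℝ} (hθ : θ ≤ 1) (ha : 0 ≤ a) (hab : a < b) :
    lowShareTwo 1 a b ≤ lowShareTwo θ a b := by
  unfold lowShareTwo
  split_ifs with h
  · exact le_rfl
  · have := one_sub_mean_div_neg (lt_of_le_of_ne ha (Ne.symm h)) hab
    exact max_le_max (by nlinarith) le_rfl

lemma lowShareTwo_one_lt {θ a b : ℝ} (hθ : θ < 1) (ha : 0 < a) (hab : a < b)
    (hba : b < 2 * a) : lowShareTwo 1 a b < lowShareTwo θ a b := by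
  have hneg := one_sub_mean_div_neg ha hab
  have hlow : (a + b) / 2 / a < 3 / 2 := by
    rw [div_lt_iff₀ ha]
    linarith
  unfold lowShareTwo
  rw [if_neg ha.ne', if_neg ha.ne', max_eq_left (by linarith)]
  exact lt_max_of_lt_left (by nlinarith)

lemma sum_topHeavy_two_le {θ : ℝ} (hθ : θ ≤ 1) {x : Fin 2 → ℝ} (hx : NonnegVec x) :
    ∑ i, topHeavy 2 θ x i * x i ≤ ∑ i, topHeavy 2 1 x i * x i := by
  rcases lt_trichotomy (x 0) (x 1) with h | h | h
  · rw [sum_topHeavy_two_of_lt θ h, sum_topHeavy_two_of_lt 1 h]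
    nlinarith [lowShareTwo_one_le hθ (hx 0) h]
  · rw [sum_topHeavy_two_of_eq θ h, sum_topHeavy_two_of_eq 1 h]
  · rw [sum_topHeavy_two_of_gt θ h, sum_topHeavy_two_of_gt 1 h]
    nlinarith [lowShareTwo_one_le hθ (hx 1) h]

lemma sum_topHeavy_two_lt {θ : ℝ} (hθ : θ < 1) {x : Fin 2 → ℝ} (hx : NonnegVec x)
    (hr : (1 / 2 < x 0 / x 1 ∧ x 0 / x 1 < 1) ∨ (1 < x 0 / x 1 ∧ x 0 / x 1 < 2)) :
    ∑ i, topHeavy 2 θ x i * x i < ∑ i, topHeavy 2 1 x i * x i := by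
  have h1 : 0 < x 1 := by
    refine lt_of_le_of_ne (hx 1) fun h => ?_
    rw [← h, div_zero] at hr
    norm_num at hr
  rw [lt_div_iff₀ h1, div_lt_iff₀ h1, lt_div_iff₀ h1, div_lt_iff₀ h1] at hr
  rcases hr with ⟨ha, hb⟩ | ⟨ha, hb⟩
  · have h : x 0 < x 1 := by linarith
    rw [sum_topHeavy_two_of_lt θ h, sum_topHeavy_two_of_lt 1 h]
    nlinarith [lowShareTwo_one_lt hθ (by linarith) h (by linarith)]
  · have h : x 1 < x 0 := by linarith
    rw [sum_topHeavy_two_of_gt θ h, sum_topHeavy_two_of_gt 1 h]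
    nlinarith [lowShareTwo_one_lt hθ h1 h hb]

/-- Theorem 1 (ii): for two agents, the Top-Heavy rule `φ¹` dominates every
other Top-Heavy rule `φ^θ`, `θ ∈ (0,1)`: its ex-post welfare is at least as
large at every profile, strictly larger at some profile, and in particular
strictly larger whenever `1/2 < x₁/x₂ < 1` or `1 < x₁/x₂ < 2`. -/
theorem top_heavy_one_dominates_two_agents
    (θ : ℝ) (hθ0 : 0 < θ) (hθ1 : θ < 1) :
    (∀ x : Fin 2 → ℝ, NonnegVec x →
      ∑ i, topHeavy 2 θ x i * x i ≤ ∑ i, topHeavy 2 1 x i * x i) ∧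
    (∀ x : Fin 2 → ℝ, NonnegVec x →
      ((1 / 2 < x 0 / x 1 ∧ x 0 / x 1 < 1) ∨ (1 < x 0 / x 1 ∧ x 0 / x 1 < 2)) →
      ∑ i, topHeavy 2 θ x i * x i < ∑ i, topHeavy 2 1 x i * x i) ∧
    (∃ x : Fin 2 → ℝ, NonnegVec x ∧
      ∑ i, topHeavy 2 θ x i * x i < ∑ i, topHeavy 2 1 x i * x i) := by
  refine ⟨fun x hx => sum_topHeavy_two_le hθ1.le hx, fun x hx => sum_topHeavy_two_lt hθ1 hx,
    ![3, 4], ?_⟩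
  have hx : NonnegVec ![(3 : ℝ), 4] := by
    intro i
    fin_cases i <;> norm_num
  exact ⟨hx, sum_topHeavy_two_lt hθ1 hx (Or.inl (by norm_num))⟩

end PaperFD
end
end

section
/- For every n ≥ 3 and every θ ∈ (0,1], the Top-Heavy rule φ^θ is undominated among symmetric measurable fair rules for a good: there is no symmetric measurable division rule ψ : [0,∞)ⁿ → Δ(N) satisfying Fair Share for a good such that ∑_i ψ_i(x)·x_i ≥ ∑_i φ^θ_i(x)·x_i for every x ∈ [0,∞)ⁿ with strict inequality for some x. In particular, for any two θ, θ′ ∈ (0,1] with θ ≠ θ′, neither of φ^θ, φ^{θ′} dominates the other. -/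
open MeasureTheory
open scoped BigOperators ENNReal

noncomputable section

namespace PaperFD

/-- The share that the Top-Heavy rule gives to an agent outside the argmax set. -/
def topHeavyLowShare (n : ℕ) (θ : ℝ) (x : Fin n → ℝ) (j : Fin n) : ℝ :=
  if x j = 0 then 0
  else max ((1 : ℝ) / n + θ / ((n : ℝ) - 1) * (1 - ((∑ k, x k) / n) / x j)) 0

lemma topHeavyLowShare_nonneg (n : ℕ) (θ : ℝ) (x : Fin n → ℝ) (j : Fin n) :
    0 ≤ topHeavyLowShare n θ x j := by
  unfold topHeavyLowShare
  split_ifs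
  · exact le_rfl
  · exact le_max_right _ _

lemma welfare_eq {n : ℕ} {p : Fin n → ℝ} (hp : ∑ i, p i = 1) (x : Fin n → ℝ) (M : ℝ) :
    ∑ i, p i * x i = M - ∑ i, p i * (M - x i) := by
  simp only [mul_sub, Finset.sum_sub_distrib, ← Finset.sum_mul, hp]
  ring

lemma topHeavy_welfare {n : ℕ} (θ : ℝ) (x : Fin n → ℝ) {m : Fin n} (hm : ∀ k, x k ≤ x m) :
    ∑ i, topHeavy n θ x i * x i = x m - ∑ i, topHeavyLowShare n θ x i * (x m - x i) := by
  classical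
  set τ : Finset (Fin n) := Finset.univ.filter fun j => ∀ k, x k ≤ x j with hτ
  have hmτ : m ∈ τ := by simpa [hτ] using hm
  have hcard : (τ.card : ℝ) ≠ 0 := by
    exact_mod_cast (Finset.card_pos.2 ⟨m, hmτ⟩).ne'
  have htop : ∀ i ∈ τ, topHeavy n θ x i
      = (1 - ∑ j ∈ τᶜ, topHeavyLowShare n θ x j) / (τ.card : ℝ) :=
    fun i hi => if_pos hi
  have hlow : ∀ i ∈ τᶜ, topHeavy n θ x i = topHeavyLowShare n θ x i :=
    fun i hi => if_neg (Finset.mem_compl.1 hi)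
  have hsum : ∑ i, topHeavy n θ x i = 1 := by
    rw [← Finset.sum_add_sum_compl τ, Finset.sum_congr rfl htop, Finset.sum_congr rfl hlow,
      Finset.sum_const, nsmul_eq_mul]
    field_simp
    ring
  rw [welfare_eq hsum x (x m)]
  congr 1
  refine Finset.sum_congr rfl fun i _ => ?_
  by_cases hi : i ∈ τ
  · have : x i = x m := le_antisymm (hm i) ((Finset.mem_filter.1 hi).2 m)
    simp [this]
  · rw [hlow i (Finset.mem_compl.2 hi)]

/-- The affine lower bound, with slope `c`, on the utilities that the shares `q` generate at the
profile `x`. For `c = θ / (n - 1)` it is the bound defining the Top-Heavy rule `φ^θ`. -/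
def HasLowerBound {n : ℕ} (c : ℝ) (x q : Fin n → ℝ) : Prop :=
  ∀ k, x k / n + c * (x k - (∑ j, x j) / n) ≤ q k * x k

lemma hasLowerBound_topHeavyLowShare {n : ℕ} (hn : 1 < n) {θ : ℝ} (hθ : 0 ≤ θ)
    {x : Fin n → ℝ} (hx : NonnegVec x) :
    HasLowerBound (θ / ((n : ℝ) - 1)) x (topHeavyLowShare n θ x) := by
  intro k
  have hn' : (1 : ℝ) < n := by exact_mod_cast hn
  have ht : 0 ≤ θ / ((n : ℝ) - 1) := div_nonneg hθ (by linarith)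
  have hs : 0 ≤ (∑ j, x j) / n :=
    div_nonneg (Finset.sum_nonneg fun j _ => hx j) (by linarith)
  unfold topHeavyLowShare
  split_ifs with h
  · rw [h]
    have := mul_nonneg ht hs
    simp only [zero_div, mul_zero, zero_sub]
    linarith
  · refine le_trans (le_of_eq ?_)
      (mul_le_mul_of_nonneg_right (le_max_left _ _) (hx k))
    field_simp

lemma topHeavyLowShare_le_of_hasLowerBound {n : ℕ} {θ : ℝ} {x q : Fin n → ℝ}
    (hx : NonnegVec x) (hq : ∀ i, 0 ≤ q i) (h : HasLowerBound (θ / ((n : ℝ) - 1)) x q)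
    (k : Fin n) : topHeavyLowShare n θ x k ≤ q k := by
  unfold topHeavyLowShare
  split_ifs with h0
  · exact hq k
  · refine max_le ?_ (hq k)
    have hpos : 0 < x k := lt_of_le_of_ne (hx k) (Ne.symm h0)
    refine le_of_mul_le_mul_right (le_trans (le_of_eq ?_) (h k)) hpos
    field_simp

/-- The profile with value `2` at `a` and `1` elsewhere. -/
def lowPeak {n : ℕ} (a : Fin n) : Fin n → ℝ := fun j => if j = a then 2 else 1

lemma nonnegVec_lowPeak {n : ℕ} (a : Fin n) : NonnegVec (lowPeak a) := by
  intro j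
  unfold lowPeak
  split_ifs <;> norm_num

lemma lowPeak_le {n : ℕ} (a k : Fin n) : lowPeak a k ≤ lowPeak a a := by
  unfold lowPeak
  split_ifs <;> norm_num at *

lemma sum_lowPeak {n : ℕ} (a : Fin n) : ∑ j, lowPeak a j = n + 1 := by
  have : ∀ j, lowPeak a j = 1 + if j = a then 1 else 0 := by
    intro j
    unfold lowPeak
    split_ifs <;> norm_num
  simp [this, Finset.sum_add_distrib]

/-- At `lowPeak a` a smaller slope forces more probability away from the top agent. -/
lemma sum_lowShare_lt_of_lowPeak {n : ℕ} (hn : 3 ≤ n) {a b : Fin n} (hab : b ≠ a) {θ c : ℝ}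
    (hθ1 : θ ≤ 1) (hc : c < θ / ((n : ℝ) - 1)) {q : Fin n → ℝ}
    (hq : HasLowerBound c (lowPeak a) q) :
    ∑ i, topHeavyLowShare n θ (lowPeak a) i * (lowPeak a a - lowPeak a i)
      < ∑ i, q i * (lowPeak a a - lowPeak a i) := by
  have hn' : (3 : ℝ) ≤ n := by exact_mod_cast hn
  have key : ∀ i, i ≠ a → topHeavyLowShare n θ (lowPeak a) i < q i := by
    intro i hi
    have h := hq i
    have hxi : lowPeak a i = 1 := if_neg hi
    rw [sum_lowPeak, hxi] at h
    have hdiv : ((n : ℝ) + 1) / n = 1 + 1 / n := by field_simp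
    rw [hdiv] at h
    have ht : θ / ((n : ℝ) - 1) ≤ 1 / 2 := by
      rw [div_le_iff₀ (by linarith)]
      linarith
    have hinv : (0 : ℝ) < 1 / n := by positivity
    unfold topHeavyLowShare
    rw [hxi, sum_lowPeak, hdiv, if_neg one_ne_zero]
    refine max_lt ?_ ?_ <;> nlinarith
  have hterm : ∀ i, i ≠ a → lowPeak a a - lowPeak a i = 1 := by
    intro i hi
    unfold lowPeak
    rw [if_pos rfl, if_neg hi]
    norm_num
  refine Finset.sum_lt_sum (fun i _ => ?_) ⟨b, Finset.mem_univ b, ?_⟩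
  · by_cases hi : i = a
    · simp [hi]
    · rw [hterm i hi]
      linarith [key i hi]
  · rw [hterm b hab]
    linarith [key b hab]

/-- The profile with value `3` at `a`, `2` at `b` and `0` elsewhere. -/
def twoPeak {n : ℕ} (a b : Fin n) : Fin n → ℝ :=
  fun j => if j = a then 3 else if j = b then 2 else 0

lemma nonnegVec_twoPeak {n : ℕ} (a b : Fin n) : NonnegVec (twoPeak a b) := by
  intro j
  unfold twoPeak
  split_ifs <;> norm_num

lemma twoPeak_le {n : ℕ} (a b k : Fin n) : twoPeak a b k ≤ twoPeak a b a := by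
  unfold twoPeak
  split_ifs <;> norm_num at *

lemma sum_twoPeak {n : ℕ} {a b : Fin n} (hab : b ≠ a) : ∑ j, twoPeak a b j = 5 := by
  have : ∀ j, twoPeak a b j = (if j = a then 3 else 0) + if j = b then 2 else 0 := by
    intro j
    unfold twoPeak
    by_cases h1 : j = a
    · subst h1
      simp [hab.symm]
    · simp [h1]
  simp only [this, Finset.sum_add_distrib, Finset.sum_ite_eq', Finset.mem_univ, if_true]
  norm_num

/-- At `twoPeak a b` a larger slope forces more probability away from the top agent. -/
lemma sum_lowShare_lt_of_twoPeak {n : ℕ} (hn : 3 ≤ n) {a b : Fin n} (hab : b ≠ a) {θ c : ℝ}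
    (hθ0 : 0 < θ) (hc : θ / ((n : ℝ) - 1) < c) {q : Fin n → ℝ} (hq0 : ∀ i, 0 ≤ q i)
    (hq : HasLowerBound c (twoPeak a b) q) :
    ∑ i, topHeavyLowShare n θ (twoPeak a b) i * (twoPeak a b a - twoPeak a b i)
      < ∑ i, q i * (twoPeak a b a - twoPeak a b i) := by
  have hn' : (3 : ℝ) ≤ n := by exact_mod_cast hn
  have key : topHeavyLowShare n θ (twoPeak a b) b < q b := by
    have h := hq b
    have hxb : twoPeak a b b = 2 := by simp [twoPeak, hab]
    rw [sum_twoPeak hab, hxb] at h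
    have ht : 0 < θ / ((n : ℝ) - 1) := div_pos hθ0 (by linarith)
    have hinv : (0 : ℝ) < 1 / n := by positivity
    have hmean : (5 : ℝ) / n ≤ 5 / 3 := by
      apply div_le_div_of_nonneg_left <;> linarith
    have h2 : (2 : ℝ) / n = 2 * (1 / n) := by ring
    rw [h2] at h
    unfold topHeavyLowShare
    rw [hxb, sum_twoPeak hab, if_neg two_ne_zero]
    refine max_lt ?_ ?_ <;> nlinarith
  refine Finset.sum_lt_sum (fun i _ => ?_) ⟨b, Finset.mem_univ b, ?_⟩
  · by_cases hia : i = a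
    · simp [hia]
    · refine mul_le_mul_of_nonneg_right ?_ (sub_nonneg.2 (twoPeak_le a b i))
      by_cases hib : i = b
      · exact hib ▸ key.le
      · have : twoPeak a b i = 0 := by simp [twoPeak, hia, hib]
        simp [topHeavyLowShare, this, hq0]
  · refine mul_lt_mul_of_pos_right key ?_
    simp [twoPeak, hab]
    norm_num

lemma FairShareGood.le_sum {n : ℕ} {ψ : (Fin n → ℝ) → (Fin n → ℝ)} (hψ : FairShareGood ψ)
    {ι : Type*} [Fintype ι] {w : ι → ℝ} (hw : ∀ k, 0 ≤ w k) (hw1 : ∑ k, w k = 1)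
    {z : ι → Fin n → ℝ} (hz : ∀ k, NonnegVec (z k)) (hmean : ∀ j, ∑ k, w k * z k j = 1)
    (i : Fin n) : (1 : ℝ) / n ≤ ∑ k, w k * (ψ (z k) i * z k i) := by
  set μ : Measure (Fin n → ℝ) := ∑ k, ENNReal.ofReal (w k) • Measure.dirac (z k) with hμ
  have hint : ∀ (f : (Fin n → ℝ) → ℝ) (k : ι),
      Integrable f (ENNReal.ofReal (w k) • Measure.dirac (z k)) := fun f k =>
    (integrable_dirac (by simp)).smul_measure ENNReal.ofReal_ne_top
  have hval : ∀ f : (Fin n → ℝ) → ℝ, ∫ x, f x ∂μ = ∑ k, w k * f (z k) := by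
    intro f
    rw [hμ, integral_finsetSum_measure fun k _ => hint f k]
    refine Finset.sum_congr rfl fun k _ => ?_
    rw [integral_smul_measure, integral_dirac, ENNReal.toReal_ofReal (hw k), smul_eq_mul]
  have hprob : IsProbabilityMeasure μ := by
    constructor
    simp only [hμ, Measure.coe_finsetSum, Finset.sum_apply, Measure.smul_apply, measure_univ,
      smul_eq_mul, mul_one]
    rw [← ENNReal.ofReal_sum_of_nonneg fun k _ => hw k, hw1, ENNReal.ofReal_one]
  have hnonneg : ∀ᵐ x ∂μ, NonnegVec x := by
    rw [ae_iff, hμ]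
    simp only [Measure.coe_finsetSum, Finset.sum_apply, Measure.smul_apply, smul_eq_mul]
    refine Finset.sum_eq_zero fun k _ => ?_
    simp [Measure.dirac_apply, hz k]
  rw [← hval fun x => ψ x i * x i]
  refine hψ μ ⟨hprob, hnonneg, fun j => ⟨?_, ?_⟩⟩ i
  · exact integrable_finsetSum_measure.2 fun k _ => hint _ k
  · rw [hval]
    exact hmean j

lemma apply_const_eq {n : ℕ} {ψ : (Fin n → ℝ) → (Fin n → ℝ)} (hr : IsRule ψ)
    (hs : IsSymmetricRule ψ) {d : ℝ} (hd : 0 ≤ d) (i : Fin n) :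
    ψ (fun _ => d) i = 1 / n := by
  have hd' : NonnegVec (fun _ : Fin n => d) := fun _ => hd
  have heq : ∀ j, ψ (fun _ => d) j = ψ (fun _ => d) i := by
    intro j
    have := hs (Equiv.swap i j) _ hd' i
    rw [Equiv.swap_apply_left] at this
    exact this.symm
  have hsum := (hr.2 _ hd').2
  rw [Finset.sum_congr rfl fun j _ => heq j] at hsum
  have hn : (n : ℝ) ≠ 0 := by
    have := i.pos
    positivity
  simp only [Finset.sum_const, Finset.card_univ, Fintype.card_fin, nsmul_eq_mul] at hsum
  field_simp
  linarith

/-- The utility of agent `i` under `ψ` in excess of the equal share. -/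
def excess {n : ℕ} (ψ : (Fin n → ℝ) → (Fin n → ℝ)) (i : Fin n) (x : Fin n → ℝ) : ℝ :=
  ψ x i * x i - x i / n

/-- Fair Share without normalizing the total mass or the common mean. -/
lemma sum_excess_nonneg {n : ℕ} {ψ : (Fin n → ℝ) → (Fin n → ℝ)} (hr : IsRule ψ)
    (hs : IsSymmetricRule ψ) (hψ : FairShareGood ψ) {ι : Type*} [Fintype ι] {w : ι → ℝ}
    (hw : ∀ k, 0 ≤ w k) {z : ι → Fin n → ℝ} (hz : ∀ k, NonnegVec (z k)) {m : ℝ}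
    (hmean : ∀ j, ∑ k, w k * z k j = m) (i : Fin n) :
    0 ≤ ∑ k, w k * excess ψ i (z k) := by
  set W := ∑ k, w k with hW
  have hW0 : 0 ≤ W := Finset.sum_nonneg fun k _ => hw k
  have hm0 : 0 ≤ m := by
    rw [← hmean i]
    exact Finset.sum_nonneg fun k _ => mul_nonneg (hw k) (hz k i)
  set ε := 1 / (2 * (1 + W + m)) with hε
  have hε0 : 0 < ε := by positivity
  have hεeq : 2 * ε * (1 + W + m) = 1 := by
    rw [hε]
    field_simp
  have hεW : 0 < 1 - ε * W := by nlinarith [mul_nonneg hε0.le hW0, mul_nonneg hε0.le hm0]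
  have hεm : 0 < 1 - ε * m := by nlinarith [mul_nonneg hε0.le hW0, mul_nonneg hε0.le hm0]
  set d := (1 - ε * m) / (1 - ε * W) with hd
  have hd0 : 0 ≤ d := (div_pos hεm hεW).le
  have hdm : (1 - ε * W) * d = 1 - ε * m := by
    rw [hd]
    field_simp
  have h := hψ.le_sum (ι := Option ι) (w := fun k => k.elim (1 - ε * W) fun k => ε * w k)
    (z := fun k => k.elim (fun _ => d) z)
    (by
      rintro (_ | k)
      · exact hεW.le
      · exact mul_nonneg hε0.le (hw k))
    (by simp [Fintype.sum_option, ← Finset.mul_sum, ← hW])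
    (by
      rintro (_ | k)
      · exact fun _ => hd0
      · exact hz k)
    (by
      intro j
      simp only [Fintype.sum_option, Option.elim_none, Option.elim_some, mul_assoc,
        ← Finset.mul_sum, hmean, hdm]
      ring)
    i
  simp only [Fintype.sum_option, Option.elim_none, Option.elim_some, mul_assoc,
    ← Finset.mul_sum, apply_const_eq hr hs hd0] at h
  have hex : ∑ k, w k * excess ψ i (z k) = ∑ k, w k * (ψ (z k) i * z k i) - m / n := by
    rw [← hmean i, Finset.sum_div, ← Finset.sum_sub_distrib]
    refine Finset.sum_congr rfl fun k _ => ?_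
    unfold excess
    ring
  rw [hex]
  have h1 : (1 - ε * W) * (1 / n * d) = 1 / n * (1 - ε * m) := by
    rw [← hdm]
    ring
  rw [h1] at h
  have h2 : 0 ≤ ε * (∑ k, w k * (ψ (z k) i * z k i) - m / n) := by
    have : 1 / (n : ℝ) * (1 - ε * m) = 1 / n - ε * (m / n) := by ring
    rw [this] at h
    linarith
  exact nonneg_of_mul_nonneg_right h2 hε0

/-- Averaging a profile over the permutations fixing `i` equalizes the other coordinates. -/
lemma sum_perm_fixing_mul {n : ℕ} (i : Fin n) (x : Fin n → ℝ) {j : Fin n} (hj : j ≠ i) :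
    ((n : ℝ) - 1) * ∑ σ : {σ : Equiv.Perm (Fin n) // σ i = i}, x (σ.1 j)
      = Fintype.card {σ : Equiv.Perm (Fin n) // σ i = i} * (∑ k, x k - x i) := by
  set S := {σ : Equiv.Perm (Fin n) // σ i = i}
  have hconst : ∀ k ∈ Finset.univ.erase i, ∑ σ : S, x (σ.1 k) = ∑ σ : S, x (σ.1 j) := by
    intro k hk
    have hk' : k ≠ i := (Finset.mem_erase.1 hk).1
    have hfix : Equiv.swap j k i = i := Equiv.swap_apply_of_ne_of_ne hj.symm hk'.symm
    have hmem : ∀ σ : S, (σ.1 * Equiv.swap j k) i = i := fun σ => by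
      rw [Equiv.Perm.mul_apply, hfix, σ.2]
    refine Finset.sum_nbij' (fun σ : S => (⟨σ.1 * Equiv.swap j k, hmem σ⟩ : S))
      (fun σ : S => (⟨σ.1 * Equiv.swap j k, hmem σ⟩ : S))
      (fun _ _ => Finset.mem_univ _) (fun _ _ => Finset.mem_univ _)
      (fun σ _ => Subtype.ext (Equiv.mul_swap_mul_self j k σ.1))
      (fun σ _ => Subtype.ext (Equiv.mul_swap_mul_self j k σ.1)) fun σ _ => ?_
    rw [Equiv.Perm.mul_apply, Equiv.swap_apply_left]
  have htotal : ∑ k ∈ Finset.univ.erase i, ∑ σ : S, x (σ.1 k)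
      = Fintype.card S * (∑ k, x k - x i) := by
    rw [Finset.sum_comm]
    have : ∀ σ : S, ∑ k ∈ Finset.univ.erase i, x (σ.1 k) = ∑ k, x k - x i := by
      intro σ
      rw [Finset.sum_erase_eq_sub (Finset.mem_univ i), Equiv.sum_comp σ.1 x, σ.2]
    rw [Finset.sum_congr rfl fun σ _ => this σ, Finset.sum_const, Finset.card_univ, nsmul_eq_mul]
  rw [Finset.sum_congr rfl hconst, Finset.sum_const, Finset.card_erase_of_mem (Finset.mem_univ i),
    nsmul_eq_mul, Finset.card_univ, Fintype.card_fin, Nat.cast_sub i.pos, Nat.cast_one] at htotal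
  exact htotal

/-- The deviation from the mean of the value of agent `i`. -/
def deviation {n : ℕ} (i : Fin n) (x : Fin n → ℝ) : ℝ := x i - (∑ k, x k) / n

lemma add_excess_nonneg {n : ℕ} (hn : 1 < n) {ψ : (Fin n → ℝ) → (Fin n → ℝ)} (hr : IsRule ψ)
    (hs : IsSymmetricRule ψ) (hψ : FairShareGood ψ) (i : Fin n) {x y : Fin n → ℝ}
    (hx : NonnegVec x) (hy : NonnegVec y) {p q : ℝ} (hp : 0 ≤ p) (hq : 0 ≤ q)
    (hpq : p * deviation i x + q * deviation i y = 0) :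
    0 ≤ p * excess ψ i x + q * excess ψ i y := by
  set S := {σ : Equiv.Perm (Fin n) // σ i = i}
  have hcard : (0 : ℝ) < Fintype.card S := by
    have : Nonempty S := ⟨⟨1, rfl⟩⟩
    exact_mod_cast Fintype.card_pos
  have hn' : (1 : ℝ) < n := by exact_mod_cast hn
  have hinv : ∀ u : Fin n → ℝ, NonnegVec u → ∀ σ : S, excess ψ i (u ∘ σ.1) = excess ψ i u := by
    intro u hu σ
    simp only [excess, hs σ.1 u hu i, Function.comp_apply, σ.2]
  have h := sum_excess_nonneg hr hs hψ (ι := S ⊕ S) (w := Sum.elim (fun _ => p) fun _ => q)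
    (z := Sum.elim (fun σ => x ∘ σ.1) fun σ => y ∘ σ.1)
    (m := Fintype.card S * (p * x i + q * y i))
    (by rintro (_ | _) <;> assumption)
    (by
      rintro (σ | σ)
      · exact fun k => hx _
      · exact fun k => hy _)
    (by
      intro j
      simp only [Fintype.sum_sum_type, Sum.elim_inl, Sum.elim_inr, Function.comp_apply,
        ← Finset.mul_sum]
      by_cases hj : j = i
      · subst hj
        have : ∀ u : Fin n → ℝ, ∑ σ : S, u (σ.1 j) = Fintype.card S * u j := by
          intro u
          rw [Finset.sum_congr rfl fun σ _ => by rw [σ.2]]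
          simp
        rw [this, this]
        ring
      · have hX := sum_perm_fixing_mul i x hj
        have hY := sum_perm_fixing_mul i y hj
        have hsum : p * ∑ k, x k + q * ∑ k, y k = n * (p * x i + q * y i) := by
          unfold deviation at hpq
          field_simp at hpq
          linarith
        refine mul_left_cancel₀ (sub_pos.2 hn').ne' ?_
        linear_combination p * hX + q * hY + (Fintype.card S : ℝ) * hsum)
    i
  simp only [Fintype.sum_sum_type, Sum.elim_inl, Sum.elim_inr, hinv x hx, hinv y hy,
    Finset.sum_const, Finset.card_univ, nsmul_eq_mul, ← mul_add] at h
  exact nonneg_of_mul_nonneg_right h hcard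

/-- If `g` takes both signs and `p f(x) + q f(y) ≥ 0` whenever `p g(x) + q g(y) = 0` with
`p, q ≥ 0`, then `f` lies above a multiple of `g`. -/
lemma exists_mul_le_of_balanced {α : Type*} (f g : α → ℝ) {u v : α} (hu : 0 < g u) (hv : g v < 0)
    (h : ∀ x y p q, 0 ≤ p → 0 ≤ q → p * g x + q * g y = 0 → 0 ≤ p * f x + q * f y) :
    ∃ c, ∀ x, c * g x ≤ f x := by
  have hcross : ∀ x y, 0 < g x → g y < 0 → f y / g y ≤ f x / g x := by
    intro x y hx hy
    have := h x y (-g y) (g x) (by linarith) hx.le (by ring)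
    rw [div_le_iff_of_neg hy, div_mul_eq_mul_div, div_le_iff₀ hx]
    linarith
  set A : Set ℝ := (fun x => f x / g x) '' {x | 0 < g x}
  have hbdd : ∀ y, g y < 0 → f y / g y ∈ lowerBounds A := by
    rintro y hy _ ⟨x, hx, rfl⟩
    exact hcross x y hx hy
  refine ⟨sInf A, fun x => ?_⟩
  rcases lt_trichotomy (g x) 0 with hx | hx | hx
  · rw [← div_le_iff_of_neg hx]
    exact le_csInf ⟨_, u, hu, rfl⟩ fun a ha => hbdd x hx ha
  · have := h x x 1 0 zero_le_one le_rfl (by simp [hx])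
    simpa [hx] using this
  · rw [← le_div_iff₀ hx]
    exact csInf_le ⟨_, hbdd v hv⟩ ⟨x, hx, rfl⟩

/-- A symmetric fair rule satisfies an affine lower bound with a slope common to all profiles. -/
lemma exists_hasLowerBound {n : ℕ} (hn : 1 < n) {ψ : (Fin n → ℝ) → (Fin n → ℝ)} (hr : IsRule ψ)
    (hs : IsSymmetricRule ψ) (hψ : FairShareGood ψ) :
    ∃ c, ∀ x, NonnegVec x → HasLowerBound c x (ψ x) := by
  have hn' : (1 : ℝ) < n := by exact_mod_cast hn
  let i : Fin n := ⟨0, by lia⟩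
  have hu : NonnegVec (lowPeak i) := nonnegVec_lowPeak i
  have hv : NonnegVec (fun j => if j = i then (0 : ℝ) else 1) := by
    intro j
    dsimp only
    split_ifs <;> norm_num
  obtain ⟨c, hc⟩ := exists_mul_le_of_balanced
    (α := {x : Fin n → ℝ // NonnegVec x}) (fun x => excess ψ i x.1) (fun x => deviation i x.1)
    (u := ⟨_, hu⟩) (v := ⟨_, hv⟩)
    (by
      simp only [deviation, sum_lowPeak, sub_pos]
      rw [div_lt_iff₀ (by linarith)]
      simp only [lowPeak, if_true]
      linarith)
    (by
      have hsum : ∑ j, (if j = i then (0 : ℝ) else 1) = n - 1 := by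
        have : ∀ j, (if j = i then (0 : ℝ) else 1) = 1 - if j = i then 1 else 0 := by
          intro j
          split_ifs <;> norm_num
        simp [this, Finset.sum_sub_distrib]
      simp only [deviation, hsum, if_true, zero_sub]
      have : 0 < ((n : ℝ) - 1) / n := div_pos (by linarith) (by linarith)
      linarith)
    (fun x y p q hp hq hpq => add_excess_nonneg hn hr hs hψ i x.2 y.2 hp hq hpq)
  refine ⟨c, fun x hx k => ?_⟩
  have h := hc ⟨x ∘ Equiv.swap i k, fun j => hx _⟩
  simp only [excess, deviation, hs _ x hx, Function.comp_apply, Equiv.swap_apply_left,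
    Equiv.sum_comp (Equiv.swap i k) x] at h
  linarith

/-- Top-Heavy rules with distinct parameters are ordered differently at two profiles. -/
lemma not_dominatesGood_topHeavy {n : ℕ} (hn : 3 ≤ n) {θ θ' : ℝ} (hθ0 : 0 < θ) (hθ1 : θ ≤ 1)
    (hθ0' : 0 < θ') (hne : θ ≠ θ') : ¬ DominatesGood (topHeavy n θ') (topHeavy n θ) := by
  rintro ⟨hdom, -⟩
  have hn' : (3 : ℝ) ≤ n := by exact_mod_cast hn
  let a : Fin n := ⟨0, by lia⟩
  let b : Fin n := ⟨1, by lia⟩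
  have hab : b ≠ a := by simp [a, b]
  rcases lt_or_gt_of_ne hne with hlt | hlt
  · have h := hdom _ (nonnegVec_twoPeak a b)
    rw [topHeavy_welfare _ _ (twoPeak_le a b), topHeavy_welfare _ _ (twoPeak_le a b)] at h
    have := sum_lowShare_lt_of_twoPeak hn hab hθ0
      (div_lt_div_of_pos_right hlt (by linarith)) (topHeavyLowShare_nonneg n θ' _)
      (hasLowerBound_topHeavyLowShare (by lia) hθ0'.le (nonnegVec_twoPeak a b))
    linarith
  · have h := hdom _ (nonnegVec_lowPeak a)
    rw [topHeavy_welfare _ _ (lowPeak_le a), topHeavy_welfare _ _ (lowPeak_le a)] at h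
    have := sum_lowShare_lt_of_lowPeak hn hab hθ1
      (div_lt_div_of_pos_right hlt (by linarith))
      (hasLowerBound_topHeavyLowShare (by lia) hθ0'.le (nonnegVec_lowPeak a))
    linarith

lemma not_dominatesGood_topHeavy_of_fair {n : ℕ} (hn : 3 ≤ n) {θ : ℝ} (hθ0 : 0 < θ)
    (hθ1 : θ ≤ 1) {ψ : (Fin n → ℝ) → (Fin n → ℝ)} (hr : IsRule ψ) (hs : IsSymmetricRule ψ)
    (hψ : FairShareGood ψ) : ¬ DominatesGood ψ (topHeavy n θ) := by
  rintro ⟨hdom, x, hx, hlt⟩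
  let a : Fin n := ⟨0, by lia⟩
  let b : Fin n := ⟨1, by lia⟩
  have hab : b ≠ a := by simp [a, b]
  obtain ⟨c, hc⟩ := exists_hasLowerBound (by lia) hr hs hψ
  rcases lt_trichotomy c (θ / ((n : ℝ) - 1)) with hcθ | rfl | hcθ
  · have hy := nonnegVec_lowPeak a
    have h := hdom _ hy
    rw [topHeavy_welfare _ _ (lowPeak_le a), welfare_eq (hr.2 _ hy).2 _ (lowPeak a a)] at h
    linarith [sum_lowShare_lt_of_lowPeak hn hab hθ1 hcθ (hc _ hy)]
  · have : Nonempty (Fin n) := ⟨a⟩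
    obtain ⟨m, hm⟩ := Finite.exists_max x
    rw [topHeavy_welfare _ _ hm, welfare_eq (hr.2 _ hx).2 _ (x m)] at hlt
    have := Finset.sum_le_sum fun i (_ : i ∈ Finset.univ) => mul_le_mul_of_nonneg_right
      (topHeavyLowShare_le_of_hasLowerBound hx (hr.2 x hx).1 (hc x hx) i) (sub_nonneg.2 (hm i))
    linarith
  · have hy := nonnegVec_twoPeak a b
    have h := hdom _ hy
    rw [topHeavy_welfare _ _ (twoPeak_le a b),
      welfare_eq (hr.2 _ hy).2 _ (twoPeak a b a)] at h
    linarith [sum_lowShare_lt_of_twoPeak hn hab hθ0 hcθ (hr.2 _ hy).1 (hc _ hy)]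

/-- Theorem 1 (iii): for `n ≥ 3` agents, every Top-Heavy rule `φ^θ`,
`θ ∈ (0,1]`, is undominated among symmetric measurable fair rules for a good;
in particular no Top-Heavy rule dominates another one. -/
theorem top_heavy_undominated
    (n : ℕ) (hn : 3 ≤ n) (θ : ℝ) (hθ0 : 0 < θ) (hθ1 : θ ≤ 1) :
    (¬ ∃ ψ : (Fin n → ℝ) → (Fin n → ℝ),
        IsRule ψ ∧ IsSymmetricRule ψ ∧ FairShareGood ψ ∧
          DominatesGood ψ (topHeavy n θ)) ∧
    (∀ θ' : ℝ, 0 < θ' → θ' ≤ 1 → θ ≠ θ' →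
      ¬ DominatesGood (topHeavy n θ) (topHeavy n θ') ∧
      ¬ DominatesGood (topHeavy n θ') (topHeavy n θ)) := by
  refine ⟨?_, fun θ' hθ0' hθ1' hne => ⟨?_, ?_⟩⟩
  · rintro ⟨ψ, hr, hs, hψ, hdom⟩
    exact not_dominatesGood_topHeavy_of_fair hn hθ0 hθ1 hr hs hψ hdom
  · exact not_dominatesGood_topHeavy hn hθ0' hθ1' hθ0 hne.symm
  · exact not_dominatesGood_topHeavy hn hθ0 hθ1 hθ0' hne

end PaperFD
end
end

section
/- For every n ≥ 3, the Proportional rule for a good is dominated by the Top-Heavy rule φ^{(n−1)/n} (that is, ∑_i φ^{(n−1)/n}_i(x)·x_i ≥ ∑_i φ^pro_i(x)·x_i for every x ∈ [0,∞)ⁿ, with strict inequality for some x), and it is not dominated by any other Top-Heavy rule φ^θ with θ ∈ (0,1], θ ≠ (n−1)/n. Equivalently, the pointwise bound x_i/∑_j x_j ≥ max{1/n + (θ/(n−1))·(1 − x̄/x_i), 0} holds for all x ≠ 0 and all i with x_i > 0 if and only if θ = (n−1)/n. -/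
open MeasureTheory
open scoped BigOperators ENNReal

noncomputable section

namespace PaperFD

/-- A non-top agent with positive utility receives the truncated lower bound. -/
lemma topHeavy_of_lt {n : ℕ} (θ : ℝ) {x : Fin n → ℝ} {i m : Fin n} (h : x i < x m)
    (hi : 0 < x i) :
    topHeavy n θ x i =
      max ((1 : ℝ) / n + θ / ((n : ℝ) - 1) * (1 - ((∑ k, x k) / n) / x i)) 0 := by
  have ht : ¬ ∀ k, x k ≤ x i := fun hk => (hk m).not_gt h
  simp [topHeavy, ht, hi.ne']

/-- A non-top agent with zero utility receives nothing. -/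
lemma topHeavy_of_eq_zero {n : ℕ} (θ : ℝ) {x : Fin n → ℝ} {i m : Fin n} (h : x i < x m)
    (hi : x i = 0) : topHeavy n θ x i = 0 := by
  have ht : ¬ ∀ k, x k ≤ x i := fun hk => (hk m).not_gt h
  simp only [topHeavy, Finset.mem_filter, Finset.mem_univ, true_and, if_neg ht, if_pos hi]

lemma sum_topHeavy {n : ℕ} (θ : ℝ) {x : Fin n → ℝ} {m : Fin n} (hm : ∀ k, x k ≤ x m) :
    ∑ i, topHeavy n θ x i = 1 := by
  set τ : Finset (Fin n) := Finset.univ.filter fun j => ∀ k, x k ≤ x j with hτ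
  have hcard : (τ.card : ℝ) ≠ 0 :=
    Nat.cast_ne_zero.2 (Finset.card_ne_zero_of_mem (a := m) (by simpa [hτ] using hm))
  have htop : ∀ i ∈ τ, topHeavy n θ x i =
      (1 - ∑ j ∈ τᶜ, topHeavy n θ x j) / (τ.card : ℝ) := by
    intro i hi
    have hlow : ∀ j ∈ τᶜ, topHeavy n θ x j = if x j = 0 then 0 else
        max ((1 : ℝ) / n + θ / ((n : ℝ) - 1) * (1 - ((∑ k, x k) / n) / x j)) 0 :=
      fun j hj => if_neg (Finset.mem_compl.1 hj)
    rw [Finset.sum_congr rfl hlow]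
    exact if_pos hi
  rw [← Finset.sum_add_sum_compl τ, Finset.sum_congr rfl htop, Finset.sum_const, nsmul_eq_mul,
    mul_div_cancel₀ _ hcard, sub_add_cancel]

lemma propGood_of_sum_ne_zero {n : ℕ} {x : Fin n → ℝ} (hS : ∑ j, x j ≠ 0) (i : Fin n) :
    propGood n x i = x i / ∑ j, x j := if_neg hS

/-- The welfare difference, measured relative to the largest utility `x m`. -/
lemma welfare_topHeavy_sub_welfare_propGood {n : ℕ} (θ : ℝ) {x : Fin n → ℝ} {m : Fin n}
    (hm : ∀ k, x k ≤ x m) (hS : ∑ j, x j ≠ 0) :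
    ∑ i, topHeavy n θ x i * x i - ∑ i, propGood n x i * x i =
      ∑ i, (propGood n x i - topHeavy n θ x i) * (x m - x i) := by
  have hp : ∑ i, propGood n x i = 1 := by
    simp_rw [propGood_of_sum_ne_zero hS, ← Finset.sum_div, div_self hS]
  have ht := sum_topHeavy θ hm
  have hexp : ∑ i, (propGood n x i - topHeavy n θ x i) * (x m - x i) =
      (∑ i, propGood n x i - ∑ i, topHeavy n θ x i) * x m
        + (∑ i, topHeavy n θ x i * x i - ∑ i, propGood n x i * x i) := by
    rw [← Finset.sum_sub_distrib, ← Finset.sum_sub_distrib, Finset.sum_mul,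
      ← Finset.sum_add_distrib]
    exact Finset.sum_congr rfl fun i _ => by ring
  rw [hexp, hp, ht]
  ring

/-- The factorization of the gap between the proportional share and the lower bound. -/
lemma share_sub_bound (N c : ℝ) {a S : ℝ} (ha : a ≠ 0) (hS : S ≠ 0) (hN : N ≠ 0) :
    a / S - (1 / N + c * (1 - S / N / a)) = (a / S - 1 / N) * (a / S - c) * (S / a) := by
  field_simp
  ring

/-- The pointwise bound at `θ = (n - 1) / n`. -/
lemma bound_le_share {n : ℕ} (hn : 2 ≤ n) {a S : ℝ} (ha : 0 < a) (hS : 0 < S) :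
    max ((1 : ℝ) / n + ((n : ℝ) - 1) / n / ((n : ℝ) - 1) * (1 - S / n / a)) 0 ≤ a / S := by
  have hn' : (2 : ℝ) ≤ n := by exact_mod_cast hn
  have hc : ((n : ℝ) - 1) / n / ((n : ℝ) - 1) = 1 / n := by
    have : (n : ℝ) - 1 ≠ 0 := by linarith
    field_simp
  refine max_le ?_ (by positivity)
  rw [hc, ← sub_nonneg, share_sub_bound _ _ ha.ne' hS.ne' (by linarith)]
  exact mul_nonneg (mul_self_nonneg _) (by positivity)

lemma welfare_propGood_le {n : ℕ} (hn : 2 ≤ n) {x : Fin n → ℝ} (hx : NonnegVec x) :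
    ∑ i, propGood n x i * x i ≤ ∑ i, topHeavy n (((n : ℝ) - 1) / n) x i * x i := by
  have hS0 : 0 ≤ ∑ j, x j := Finset.sum_nonneg fun i _ => hx i
  rcases hS0.eq_or_lt with hS | hS
  · have h0 : ∀ i, x i = 0 := fun i =>
      (Finset.sum_eq_zero_iff_of_nonneg fun i _ => hx i).1 hS.symm i (Finset.mem_univ i)
    simp [h0]
  · have : Nonempty (Fin n) := ⟨⟨0, by omega⟩⟩
    obtain ⟨m, hm⟩ := Finite.exists_max x
    rw [← sub_nonneg, welfare_topHeavy_sub_welfare_propGood _ hm hS.ne']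
    refine Finset.sum_nonneg fun i _ => ?_
    rcases (hm i).eq_or_lt with h | h
    · simp [h]
    refine mul_nonneg (sub_nonneg.2 ?_) (by linarith)
    rw [propGood_of_sum_ne_zero hS.ne']
    rcases (hx i).eq_or_lt with hi | hi
    · rw [topHeavy_of_eq_zero _ h hi.symm]
      exact div_nonneg (hx i) hS0
    · rw [topHeavy_of_lt _ h hi]
      exact bound_le_share hn hi hS

/-- The profile in which agents `i` and `j` have utilities `p` and `1 - p`, all others zero. -/
def twoAgent {n : ℕ} (i j : Fin n) (p : ℝ) : Fin n → ℝ := Pi.single i p + Pi.single j (1 - p)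

section twoAgent

variable {n : ℕ} {i j : Fin n} {p : ℝ}

lemma twoAgent_left (hij : i ≠ j) : twoAgent i j p i = p := by
  simp [twoAgent, hij]

lemma twoAgent_right (hij : i ≠ j) : twoAgent i j p j = 1 - p := by
  simp [twoAgent, hij.symm]

lemma twoAgent_of_ne {k : Fin n} (hi : k ≠ i) (hj : k ≠ j) : twoAgent i j p k = 0 := by
  simp [twoAgent, hi, hj]

lemma nonnegVec_twoAgent (h0 : 0 ≤ p) (h1 : p ≤ 1) : NonnegVec (twoAgent i j p) := fun k =>
  add_nonneg ((Pi.single_nonneg.2 h0 : (0 : Fin n → ℝ) ≤ Pi.single i p) k)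
    ((Pi.single_nonneg.2 (sub_nonneg.2 h1) : (0 : Fin n → ℝ) ≤ Pi.single j (1 - p)) k)

lemma sum_twoAgent : ∑ k, twoAgent i j p k = 1 := by
  simp [twoAgent, Finset.sum_add_distrib]

lemma welfare_twoAgent (θ : ℝ) (hij : i ≠ j) (h0 : 0 < p) (h1 : p < 1 / 2) :
    ∑ k, topHeavy n θ (twoAgent i j p) k * twoAgent i j p k
        - ∑ k, propGood n (twoAgent i j p) k * twoAgent i j p k =
      (p - max ((1 : ℝ) / n + θ / ((n : ℝ) - 1) * (1 - 1 / n / p)) 0) * (1 - 2 * p) := by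
  have hi := twoAgent_left (p := p) hij
  have hj := twoAgent_right (p := p) hij
  have hm : ∀ k, twoAgent i j p k ≤ twoAgent i j p j := by
    intro k
    rw [hj]
    by_cases hki : k = i
    · rw [hki, hi]; linarith
    by_cases hkj : k = j
    · rw [hkj, hj]
    · rw [twoAgent_of_ne hki hkj]; linarith
  have hS : ∑ k, twoAgent i j p k ≠ 0 := by simp [sum_twoAgent]
  rw [welfare_topHeavy_sub_welfare_propGood θ hm hS, Finset.sum_eq_single i]
  · rw [topHeavy_of_lt θ (m := j) (by rw [hi, hj]; linarith) (by rwa [hi]),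
      propGood_of_sum_ne_zero hS, sum_twoAgent, hi, hj]
    ring
  · intro k _ hki
    by_cases hkj : k = j
    · simp [hkj]
    have hk := twoAgent_of_ne (p := p) hki hkj
    rw [topHeavy_of_eq_zero θ (m := j) (by rw [hk, hj]; linarith) hk,
      propGood_of_sum_ne_zero hS, hk]
    simp
  · simp

end twoAgent

/-- If `θ ≠ (n - 1) / n`, some share below one half violates the pointwise bound. -/
lemma exists_share_lt_bound {n : ℕ} (hn : 3 ≤ n) {θ : ℝ} (h0 : 0 < θ) (h1 : θ ≤ 1)
    (hθ : θ ≠ ((n : ℝ) - 1) / n) :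
    ∃ p : ℝ, 0 < p ∧ p < 1 / 2 ∧
      p < max ((1 : ℝ) / n + θ / ((n : ℝ) - 1) * (1 - 1 / n / p)) 0 := by
  have hn' : (3 : ℝ) ≤ n := by exact_mod_cast hn
  have hn1 : (0 : ℝ) < (n : ℝ) - 1 := by linarith
  set c := θ / ((n : ℝ) - 1) with hc
  have hc0 : 0 < c := by positivity
  have hc1 : c ≤ 1 / 2 := by
    rw [hc, div_le_iff₀ hn1]; linarith
  have hN0 : (0 : ℝ) < 1 / n := by positivity
  have hN1 : (1 : ℝ) / n < 1 / 2 := one_div_lt_one_div_of_lt (by norm_num) (by linarith)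
  have hne : (1 : ℝ) / n ≠ c := by
    intro h
    apply hθ
    rw [hc, eq_div_iff hn1.ne'] at h
    rw [← h]; ring
  have hp : 0 < (1 / n + c) / 2 := by positivity
  refine ⟨(1 / n + c) / 2, hp, by linarith, lt_max_of_lt_left ?_⟩
  have hgap := share_sub_bound (n : ℝ) c hp.ne' one_ne_zero (by linarith)
  rw [div_one] at hgap
  rw [← sub_neg, hgap]
  refine mul_neg_of_neg_of_pos ?_ (by positivity)
  nlinarith [sq_pos_of_ne_zero (sub_ne_zero.2 hne)]

/-- Theorem 1 (iv): for `n ≥ 3`, the Proportional rule for a good is dominated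
by the Top-Heavy rule `φ^{(n−1)/n}` and by no other Top-Heavy rule.
Equivalently, the pointwise bound
`x_i/∑_j x_j ≥ max{1/n + (θ/(n−1))(1 − x̄/x_i), 0}` (for all `x ≠ 0` in the
positive orthant and all `i` with `x_i > 0`) holds iff `θ = (n−1)/n`. -/
theorem proportional_dominated_by_top_heavy
    (n : ℕ) (hn : 3 ≤ n) :
    DominatesGood (topHeavy n (((n : ℝ) - 1) / n)) (propGood n) ∧
    (∀ θ : ℝ, 0 < θ → θ ≤ 1 → θ ≠ ((n : ℝ) - 1) / n →
      ¬ DominatesGood (topHeavy n θ) (propGood n)) ∧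
    (∀ θ : ℝ, 0 < θ → θ ≤ 1 →
      ((∀ x : Fin n → ℝ, NonnegVec x → (∑ j, x j) ≠ 0 → ∀ i, 0 < x i →
          max ((1 : ℝ) / n + θ / ((n : ℝ) - 1) * (1 - ((∑ j, x j) / n) / x i)) 0
            ≤ x i / ∑ j, x j)
        ↔ θ = ((n : ℝ) - 1) / n)) := by
  have hn' : (3 : ℝ) ≤ n := by exact_mod_cast hn
  have hn1 : (n : ℝ) - 1 ≠ 0 := by linarith
  let i₀ : Fin n := ⟨0, by omega⟩
  let i₁ : Fin n := ⟨1, by omega⟩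
  have hij : i₀ ≠ i₁ := by simp [i₀, i₁]
  refine ⟨⟨fun x hx => welfare_propGood_le (by omega) hx, ?_⟩, ?_, ?_⟩
  · have hp0 : (0 : ℝ) < 1 / (2 * n) := by positivity
    have hp1 : (1 : ℝ) / (2 * n) < 1 / 2 :=
      one_div_lt_one_div_of_lt (by norm_num) (by linarith)
    refine ⟨twoAgent i₀ i₁ (1 / (2 * n)), nonnegVec_twoAgent hp0.le (by linarith), ?_⟩
    rw [← sub_pos, welfare_twoAgent _ hij hp0 hp1]
    have hzero : (1 : ℝ) / n + ((n : ℝ) - 1) / n / ((n : ℝ) - 1) * (1 - 1 / n / (1 / (2 * n)))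
        = 0 := by
      field_simp
      ring
    rw [hzero, max_self, sub_zero]
    exact mul_pos hp0 (by linarith)
  · intro θ h0 h1 hθ hdom
    obtain ⟨p, hp0, hp1, hp⟩ := exists_share_lt_bound hn h0 h1 hθ
    have h := hdom.1 _ (nonnegVec_twoAgent (i := i₀) (j := i₁) hp0.le (by linarith))
    rw [← sub_nonneg, welfare_twoAgent θ hij hp0 hp1] at h
    exact h.not_gt (mul_neg_of_neg_of_pos (sub_neg.2 hp) (by linarith))
  · intro θ h0 h1
    constructor
    · intro hbound
      by_contra hθ
      obtain ⟨p, hp0, hp1, hp⟩ := exists_share_lt_bound hn h0 h1 hθ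
      have h := hbound (twoAgent i₀ i₁ p) (nonnegVec_twoAgent hp0.le (by linarith))
        (by simp [sum_twoAgent]) i₀ (by rwa [twoAgent_left hij])
      rw [sum_twoAgent, twoAgent_left hij, div_one] at h
      exact h.not_gt hp
    · rintro rfl x hx hS i hi
      exact bound_le_share (by omega) hi
        (lt_of_le_of_ne (Finset.sum_nonneg fun i _ => hx i) hS.symm)

end PaperFD
end
end

section
/- For every n ≥ 2, the Bottom-Heavy rule φ¹ dominates every other symmetric measurable division rule for a bad satisfying Fair Share: if ψ : [0,∞)ⁿ → Δ(N) is symmetric, measurable, satisfies Fair Share for a bad, and ψ ≠ φ¹, then ∑_i φ¹_i(x)·x_i ≤ ∑_i ψ_i(x)·x_i for every x ∈ [0,∞)ⁿ, with strict inequality for at least one x. -/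
open MeasureTheory
open scoped BigOperators ENNReal

noncomputable section

namespace PaperFD

/-! ### Fair Share on finitely supported measures -/

/-- A symmetric rule gives equal shares to agents with equal disutility. -/
lemma IsSymmetricRule.eq_of_eq {n : ℕ} {ψ : (Fin n → ℝ) → (Fin n → ℝ)}
    (hsym : IsSymmetricRule ψ) {x : Fin n → ℝ} (hx : NonnegVec x) {i j : Fin n}
    (hij : x i = x j) : ψ x i = ψ x j := by
  have hswap : x ∘ Equiv.swap i j = x := by
    ext k
    simp only [Function.comp_apply, Equiv.swap_apply_def]
    split_ifs with h1 h2
    · rw [h1, hij]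
    · rw [h2, hij]
    · rfl
  have h := hsym (Equiv.swap i j) x hx i
  rwa [hswap, Equiv.swap_apply_left] at h

lemma FairShareBad.sum_le_of_sum_eq_one {n : ℕ} {ψ : (Fin n → ℝ) → (Fin n → ℝ)}
    (hfs : FairShareBad ψ) {ι : Type*} [Fintype ι] (y : ι → Fin n → ℝ)
    (hy : ∀ s, NonnegVec (y s)) (α : ι → ℝ) (hα : ∀ s, 0 ≤ α s) (hsum : ∑ s, α s = 1)
    (hmean : ∀ b, ∑ s, α s * y s b = 1) (a : Fin n) :
    ∑ s, α s * (ψ (y s) a * y s a) ≤ 1 / n := by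
  set μ : Measure (Fin n → ℝ) :=
    ∑ s, ENNReal.ofReal (α s) • Measure.dirac (y s) with hμ
  have hint (f : (Fin n → ℝ) → ℝ) (s : ι) :
      Integrable f (ENNReal.ofReal (α s) • Measure.dirac (y s)) :=
    (integrable_dirac (by simp)).smul_measure ENNReal.ofReal_ne_top
  have hval (f : (Fin n → ℝ) → ℝ) : ∫ x, f x ∂μ = ∑ s, α s * f (y s) := by
    rw [hμ, integral_finsetSum_measure fun s _ => hint f s]
    refine Finset.sum_congr rfl fun s _ => ?_
    rw [integral_smul_measure, integral_dirac, ENNReal.toReal_ofReal (hα s), smul_eq_mul]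
  have hnorm : IsNormalizedProblem μ := by
    refine ⟨⟨?_⟩, ?_, fun b => ⟨?_, ?_⟩⟩
    · simp only [hμ, Measure.finsetSum_apply, Measure.smul_apply, measure_univ, smul_eq_mul,
        mul_one]
      rw [← ENNReal.ofReal_sum_of_nonneg fun s _ => hα s, hsum, ENNReal.ofReal_one]
    · rw [hμ, ae_finsetSum_measure_iff]
      intro s _
      refine Measure.ae_smul_measure ?_ _
      rw [ae_dirac_eq]
      exact hy s
    · rw [hμ, integrable_finsetSum_measure]
      exact fun s _ => hint _ s
    · rw [hval, hmean]
  have h := hfs μ hnorm a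
  rwa [hval] at h

/-- For symmetric rules, Fair Share extends to finitely supported measures of arbitrary total mass
under which all agents have the same mean: rescale and add an atom at a constant profile. -/
lemma FairShareBad.sum_le_of_mean_eq {n : ℕ} {ψ : (Fin n → ℝ) → (Fin n → ℝ)}
    (hrule : IsRule ψ) (hsym : IsSymmetricRule ψ) (hfs : FairShareBad ψ)
    {ι : Type*} [Fintype ι] (y : ι → Fin n → ℝ)
    (hy : ∀ s, NonnegVec (y s)) (α : ι → ℝ) (hα : ∀ s, 0 ≤ α s) (m : ℝ)
    (hmean : ∀ b, ∑ s, α s * y s b = m) (a : Fin n) :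
    ∑ s, α s * (ψ (y s) a * y s a) ≤ m / n := by
  have hn : (0 : ℝ) < n := by exact_mod_cast a.pos
  have hm : 0 ≤ m := hmean a ▸ Finset.sum_nonneg fun s _ => mul_nonneg (hα s) (hy s a)
  set A := ∑ s, α s with hA
  have hA0 : 0 ≤ A := Finset.sum_nonneg fun s _ => hα s
  set δ := 1 / (A + m + 1) with hδ
  have hδ0 : 0 < δ := by positivity
  have hδ1 : δ * (A + m + 1) = 1 := by rw [hδ]; field_simp
  have hδA : 0 < 1 - δ * A := by nlinarith
  have hδm : 0 < 1 - δ * m := by nlinarith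
  set v := (1 - δ * m) / (1 - δ * A) with hv
  have hv0 : 0 ≤ v := by positivity
  have hvA : (1 - δ * A) * v = 1 - δ * m := by rw [hv]; field_simp
  have hconst : ψ (fun _ => v) a = 1 / n := by
    have hsum := (hrule.2 (fun _ => v) fun _ => hv0).2
    rw [Finset.sum_congr rfl fun j _ => hsym.eq_of_eq (x := fun _ => v) (fun _ => hv0)
      (i := j) (j := a) rfl] at hsum
    simp only [Finset.sum_const, Finset.card_univ, Fintype.card_fin, nsmul_eq_mul] at hsum
    rw [eq_div_iff hn.ne', mul_comm, hsum]
  have h := hfs.sum_le_of_sum_eq_one (ι := Option ι)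
    (fun o => o.elim (fun _ => v) y) ?_ (fun o => o.elim (1 - δ * A) fun s => δ * α s) ?_ ?_ ?_ a
  · simp only [Fintype.sum_option, Option.elim_none, Option.elim_some, hconst, mul_assoc,
      ← Finset.mul_sum] at h
    have h2 : (1 - δ * A) * (1 / n * v) = (1 - δ * m) / n := by
      rw [← hvA]; ring
    rw [h2] at h
    have h3 : δ * ∑ s, α s * (ψ (y s) a * y s a) ≤ δ * (m / n) := by
      have : (1 : ℝ) / n - (1 - δ * m) / n = δ * (m / n) := by ring
      linarith
    exact le_of_mul_le_mul_left h3 hδ0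
  · rintro (_ | s)
    · exact fun _ => hv0
    · exact hy s
  · rintro (_ | s)
    · exact hδA.le
    · exact mul_nonneg hδ0.le (hα s)
  · simp only [Fintype.sum_option, Option.elim_none, Option.elim_some, ← Finset.mul_sum]
    ring
  · intro b
    simp only [Fintype.sum_option, Option.elim_none, Option.elim_some, mul_assoc,
      ← Finset.mul_sum, hmean b, hvA]
    ring

/-! ### The bound on the shares of the agents with low disutility -/

/-- The largest share that Fair Share lets an agent keep under the Bottom-Heavy rule. -/
def cap {n : ℕ} (x : Fin n → ℝ) (j : Fin n) : ℝ :=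
  (∑ k ∈ Finset.univ.erase j, x k) / ((n : ℝ) * ((n : ℝ) - 1) * x j)

lemma cap_eq {n : ℕ} (x : Fin n → ℝ) (j : Fin n) :
    cap x j = (∑ k, x k - x j) / ((n : ℝ) * ((n : ℝ) - 1) * x j) := by
  rw [cap, ← Finset.sum_erase_add _ _ (Finset.mem_univ j), add_sub_cancel_right]

/-- Averaging a function of `σ a` over all permutations `σ`. -/
lemma card_mul_sum_perm_apply {n : ℕ} (g : Fin n → ℝ) (a : Fin n) :
    n * ∑ σ : Equiv.Perm (Fin n), g (σ a) = n.factorial * ∑ i, g i := by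
  have h (b : Fin n) : ∑ σ : Equiv.Perm (Fin n), g (σ b) = ∑ σ : Equiv.Perm (Fin n), g (σ a) :=
    Fintype.sum_equiv (Equiv.mulRight (Equiv.swap a b)) _ _ fun σ => by simp
  calc n * ∑ σ : Equiv.Perm (Fin n), g (σ a)
      = ∑ b, ∑ σ : Equiv.Perm (Fin n), g (σ b) := by simp [h]
    _ = ∑ σ : Equiv.Perm (Fin n), ∑ b, g (σ b) := Finset.sum_comm
    _ = n.factorial * ∑ i, g i := by
      simp [Equiv.sum_comp, Fintype.card_perm]

/-- Fair Share bounds the total share of a set `T` of agents by its total cap, provided the average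
cap on `T` is at least `1 / n`. -/
lemma sum_le_sum_cap {n : ℕ} (hn : 2 ≤ n) {ψ : (Fin n → ℝ) → (Fin n → ℝ)}
    (hrule : IsRule ψ) (hsym : IsSymmetricRule ψ) (hfs : FairShareBad ψ)
    {x : Fin n → ℝ} (hx : ∀ i, 0 < x i) (T : Finset (Fin n))
    (hT : (T.card : ℝ) ≤ n * ∑ j ∈ T, cap x j) :
    ∑ j ∈ T, ψ x j ≤ ∑ j ∈ T, cap x j := by
  have hn0 : (0 : ℝ) < n := by positivity
  have hn1 : (0 : ℝ) < n - 1 := by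
    have : (2 : ℝ) ≤ n := by exact_mod_cast hn
    linarith
  have hx0 : NonnegVec x := fun i => (hx i).le
  let a : Fin n := ⟨0, by omega⟩
  set P : ℝ := n.factorial / n with hP
  have hP0 : 0 < P := by positivity
  have hperm (g : Fin n → ℝ) : ∑ σ : Equiv.Perm (Fin n), g (σ a) = P * ∑ i, g i := by
    have := card_mul_sum_perm_apply g a
    rw [hP]; field_simp; linarith
  let f : Fin n → ℝ := fun i => if i ∈ T then 1 / x i else 0
  have hf (i : Fin n) : 0 ≤ f i := by
    have := hx i
    simp only [f]; split_ifs <;> positivity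
  have hsumf (g : Fin n → ℝ) : ∑ i, f i * g i = ∑ i ∈ T, 1 / x i * g i := by
    simp [f, ite_mul, Finset.sum_ite_mem]
  have hA : ∑ σ : Equiv.Perm (Fin n), f (σ a) * x (σ a) = P * T.card := by
    rw [hperm fun i => f i * x i, hsumf,
      Finset.sum_congr rfl fun i _ => one_div_mul_cancel (hx i).ne', Finset.sum_const,
      nsmul_one]
  have hB (b : Fin n) (hb : b ≠ a) :
      ∑ σ : Equiv.Perm (Fin n), f (σ a) * x (σ b) = P * (n * ∑ j ∈ T, cap x j) := by
    have hconst (c : Fin n) (hc : c ≠ a) : ∑ σ : Equiv.Perm (Fin n), f (σ a) * x (σ c)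
        = ∑ σ : Equiv.Perm (Fin n), f (σ a) * x (σ b) :=
      Fintype.sum_equiv (Equiv.mulRight (Equiv.swap b c)) _ _ fun σ => by
        simp [Equiv.swap_apply_of_ne_of_ne hb.symm hc.symm]
    have htot : ∑ c ∈ Finset.univ.erase a, ∑ σ : Equiv.Perm (Fin n), f (σ a) * x (σ c)
        = (n - 1) * ∑ σ : Equiv.Perm (Fin n), f (σ a) * x (σ b) := by
      rw [Finset.sum_congr rfl fun c hc => hconst c (Finset.ne_of_mem_erase hc), Finset.sum_const,
        Finset.card_erase_of_mem (Finset.mem_univ a), nsmul_eq_mul, Finset.card_univ,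
        Fintype.card_fin, Nat.cast_sub (by omega), Nat.cast_one]
    have htot2 : ∑ c ∈ Finset.univ.erase a, ∑ σ : Equiv.Perm (Fin n), f (σ a) * x (σ c)
        = (n - 1) * (P * (n * ∑ j ∈ T, cap x j)) := by
      rw [Finset.sum_comm]
      have (σ : Equiv.Perm (Fin n)) : ∑ c ∈ Finset.univ.erase a, f (σ a) * x (σ c)
          = f (σ a) * (∑ k, x k - x (σ a)) := by
        rw [← Finset.mul_sum, ← Equiv.sum_comp σ x,
          ← Finset.sum_erase_add _ _ (Finset.mem_univ a), add_sub_cancel_right]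
      rw [Finset.sum_congr rfl fun σ _ => this σ, hperm fun i => f i * (∑ k, x k - x i), hsumf,
        mul_left_comm]
      congr 1
      rw [Finset.mul_sum, Finset.mul_sum]
      refine Finset.sum_congr rfl fun j _ => ?_
      have := hx j
      rw [cap_eq]
      field_simp
    exact mul_left_cancel₀ hn1.ne' (htot.symm.trans htot2)
  set K : ℝ := P * (n * ∑ j ∈ T, cap x j) - P * T.card with hK
  have hK0 : 0 ≤ K := sub_nonneg.2 (mul_le_mul_of_nonneg_left hT hP0.le)
  have hsingle : NonnegVec (Pi.single a K : Fin n → ℝ) := by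
    have h0 : (0 : Fin n → ℝ) ≤ Pi.single a K := Pi.single_nonneg.2 hK0
    exact fun i => h0 i
  have h := hfs.sum_le_of_mean_eq hrule hsym (ι := Option (Equiv.Perm (Fin n)))
    (fun o => o.elim (Pi.single a K) fun σ => x ∘ σ) ?_ (fun o => o.elim 1 fun σ => f (σ a)) ?_
    (P * (n * ∑ j ∈ T, cap x j)) ?_ a
  · simp only [Fintype.sum_option, Option.elim_none, Option.elim_some, Function.comp_apply,
      hsym _ x hx0, hperm fun i => f i * (ψ x i * x i), hsumf] at h
    rw [Finset.sum_congr rfl fun i _ =>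
      show 1 / x i * (ψ x i * x i) = ψ x i by have := hx i; field_simp] at h
    have h0 : 0 ≤ 1 * (ψ (Pi.single a K) a * (Pi.single a K : Fin n → ℝ) a) :=
      mul_nonneg zero_le_one (mul_nonneg ((hrule.2 _ hsingle).1 a) (hsingle a))
    have h1 : P * (n * ∑ j ∈ T, cap x j) / n = P * ∑ j ∈ T, cap x j := by field_simp
    exact le_of_mul_le_mul_left (by linarith) hP0
  · rintro (_ | σ)
    · exact hsingle
    · exact fun i => hx0 (σ i)
  · rintro (_ | σ)
    · exact zero_le_one
    · exact hf _
  · intro b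
    simp only [Fintype.sum_option, Option.elim_none, Option.elim_some, Function.comp_apply]
    by_cases hb : b = a
    · rw [hb, hA, Pi.single_eq_same, hK]; ring
    · rw [hB b hb, Pi.single_eq_of_ne hb]; ring

/-- On a lower set of agents, the average cap is at least `1 / n`. -/
lemma card_le_mul_sum_cap {n : ℕ} (hn : 2 ≤ n) {x : Fin n → ℝ} (hx : ∀ i, 0 < x i) (c : ℝ) :
    ((Finset.univ.filter fun j => x j ≤ c).card : ℝ) ≤
      n * ∑ j ∈ Finset.univ.filter (fun j => x j ≤ c), cap x j := by
  set T := Finset.univ.filter fun j => x j ≤ c with hT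
  have hn0 : (0 : ℝ) < n := by positivity
  have hn1 : (0 : ℝ) < n - 1 := by
    have : (2 : ℝ) ≤ n := by exact_mod_cast hn
    linarith
  set m : ℝ := (∑ k, x k) / n with hm
  have hX : ∑ k, x k = n * m := by rw [hm]; field_simp
  have hm0 : 0 < m :=
    div_pos (Finset.sum_pos (fun k _ => hx k) ⟨⟨0, by omega⟩, Finset.mem_univ _⟩) hn0
  have hdev : 0 ≤ ∑ j ∈ T, (m - x j) := by
    by_cases hc : c ≤ m
    · exact Finset.sum_nonneg fun j hj => sub_nonneg.2 ((Finset.mem_filter.1 hj).2.trans hc)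
    · have htot : ∑ j ∈ T, (m - x j) + ∑ j ∈ Tᶜ, (m - x j) = 0 := by
        rw [Finset.sum_add_sum_compl, Finset.sum_sub_distrib, hX]
        simp
      have hcompl : ∑ j ∈ Tᶜ, (m - x j) ≤ 0 := Finset.sum_nonpos fun j hj => by
        simp only [hT, Finset.mem_compl, Finset.mem_filter, Finset.mem_univ, true_and,
          not_le] at hj
        linarith
      linarith
  have hterm (j : Fin n) : 1 + n / ((n - 1) * m) * (m - x j) ≤ n * cap x j := by
    have hj := hx j
    rw [cap_eq, hX, ← sub_nonneg]
    have : n * ((n * m - x j) / (n * (n - 1) * x j)) - (1 + n / ((n - 1) * m) * (m - x j))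
        = n * (m - x j) ^ 2 / ((n - 1) * m * x j) := by
      field_simp
      ring
    rw [this]
    positivity
  calc (T.card : ℝ) ≤ T.card + n / ((n - 1) * m) * ∑ j ∈ T, (m - x j) :=
        le_add_of_nonneg_right (by positivity)
    _ = ∑ j ∈ T, (1 + n / ((n - 1) * m) * (m - x j)) := by
      rw [Finset.sum_add_distrib, Finset.mul_sum]; simp
    _ ≤ ∑ j ∈ T, n * cap x j := Finset.sum_le_sum fun j _ => hterm j
    _ = n * ∑ j ∈ T, cap x j := (Finset.mul_sum _ _ _).symm

/-! ### Stochastic dominance -/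

/-- Summation by parts: if all partial sums of `d` along the levels of `x` below `M` are
nonnegative, then so is `∑ d (M - x)`, and it vanishes only if all these partial sums do. -/
lemma sum_mul_sub_nonneg {ι : Type*} (x d : ι → ℝ) (s : Finset ι) :
    ∀ M : ℝ, (∀ j ∈ s, x j ≤ M) → (∀ c < M, 0 ≤ ∑ j ∈ s with x j ≤ c, d j) →
      0 ≤ ∑ j ∈ s, d j * (M - x j) ∧
      (∑ j ∈ s, d j * (M - x j) = 0 → ∀ c < M, ∑ j ∈ s with x j ≤ c, d j = 0) := by
  classical
  induction s using Finset.induction_on_max_value x with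
  | empty => simp
  | insert a s ha hmax ih =>
    intro M hM hD
    have hfilter (c : ℝ) (hc : c < x a) :
        ((insert a s).filter fun j => x j ≤ c) = s.filter fun j => x j ≤ c := by
      rw [Finset.filter_insert, if_neg (not_le.2 hc)]
    have hfull (c : ℝ) (hc : x a ≤ c) :
        ((insert a s).filter fun j => x j ≤ c) = insert a s := by
      refine Finset.filter_true_of_mem fun j hj => ?_
      rcases Finset.mem_insert.1 hj with rfl | hj
      · exact hc
      · exact (hmax j hj).trans hc
    have haM : x a ≤ M := hM a (Finset.mem_insert_self a s)
    obtain ⟨ih1, ih2⟩ := ih (x a) hmax fun c hc => by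
      rw [← hfilter c hc]; exact hD c (hc.trans_le haM)
    have hsplit : ∑ j ∈ insert a s, d j * (M - x j)
        = (∑ j ∈ insert a s, d j) * (M - x a) + ∑ j ∈ s, d j * (x a - x j) := by
      have : ∑ j ∈ s, d j * (x a - x j) = ∑ j ∈ insert a s, d j * (x a - x j) := by
        rw [Finset.sum_insert ha]; simp
      rw [this, Finset.sum_mul, ← Finset.sum_add_distrib]
      exact Finset.sum_congr rfl fun j _ => by ring
    have hfirst : 0 ≤ (∑ j ∈ insert a s, d j) * (M - x a) := by
      rcases haM.lt_or_eq with h | h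
      · have := hD (x a) h
        rw [hfull _ le_rfl] at this
        exact mul_nonneg this (sub_nonneg.2 haM)
      · simp [h]
    rw [hsplit]
    refine ⟨add_nonneg hfirst ih1, fun h0 c hc => ?_⟩
    rcases lt_or_ge c (x a) with hca | hca
    · rw [hfilter c hca]
      exact ih2 (by linarith) c hca
    · rw [hfull c hca]
      have h1 : (∑ j ∈ insert a s, d j) * (M - x a) = 0 := by linarith
      exact (mul_eq_zero.1 h1).resolve_right (sub_ne_zero.2 (hca.trans_lt hc).ne')

/-- If `p` puts at least as much weight as `q` on every lower set of `x`, then it has a lower cost;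
if moreover both treat ties of `x` equally, the cost is strictly lower unless `p = q`. -/
lemma cost_le_of_dominance {ι : Type*} [Fintype ι] (x p q : ι → ℝ)
    (hsum : ∑ i, p i = ∑ i, q i)
    (hdom : ∀ c, ∑ j with x j ≤ c, q j ≤ ∑ j with x j ≤ c, p j)
    (hp : ∀ i j, x i = x j → p i = p j) (hq : ∀ i j, x i = x j → q i = q j) :
    ∑ i, p i * x i ≤ ∑ i, q i * x i ∧ (∑ i, p i * x i = ∑ i, q i * x i → p = q) := by
  obtain ⟨M, hM⟩ := (Set.finite_range x).bddAbove
  have hM' (j : ι) : x j ≤ M := hM ⟨j, rfl⟩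
  obtain ⟨h1, h2⟩ := sum_mul_sub_nonneg x (p - q) Finset.univ (M + 1)
    (fun j _ => (hM' j).trans (by linarith))
    (fun c _ => by simpa [Finset.sum_sub_distrib] using hdom c)
  have hval : ∑ j, (p - q) j * (M + 1 - x j) = ∑ i, q i * x i - ∑ i, p i * x i := by
    have : ∑ j, (p - q) j * (M + 1 - x j)
        = (M + 1) * (∑ i, p i - ∑ i, q i) + (∑ i, q i * x i - ∑ i, p i * x i) := by
      rw [← Finset.sum_sub_distrib, ← Finset.sum_sub_distrib, Finset.mul_sum,
        ← Finset.sum_add_distrib]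
      exact Finset.sum_congr rfl fun j _ => by simp only [Pi.sub_apply]; ring
    rw [this, hsum]; ring
  rw [hval] at h1 h2
  refine ⟨sub_nonneg.1 h1, fun heq => ?_⟩
  have hzero := h2 (by rw [heq, sub_self])
  by_contra hne
  have hex : (Finset.univ.filter fun i => p i ≠ q i).Nonempty := by
    obtain ⟨i, hi⟩ := Function.ne_iff.1 hne
    exact ⟨i, by simpa using hi⟩
  obtain ⟨i, hi, hmin⟩ := Finset.exists_min_image _ x hex
  simp only [Finset.mem_filter, Finset.mem_univ, true_and] at hi hmin
  have hz := hzero (x i) ((hM' i).trans_lt (by linarith))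
  have hsub : ∑ j with x j = x i, (p - q) j = ∑ j with x j ≤ x i, (p - q) j := by
    refine Finset.sum_subset (fun j hj => ?_) fun j hj hj' => ?_
    · simp only [Finset.mem_filter, Finset.mem_univ, true_and] at hj ⊢
      exact hj.le
    · simp only [Finset.mem_filter, Finset.mem_univ, true_and] at hj hj'
      by_contra hd
      exact hj' (hj.antisymm (hmin j fun h => hd (by simp [h])))
  have hcard : ∑ j with x j = x i, (p - q) j
      = ((Finset.univ.filter fun j => x j = x i).card : ℝ) * (p i - q i) := by
    rw [← nsmul_eq_mul, ← Finset.sum_const]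
    refine Finset.sum_congr rfl fun j hj => ?_
    have hj := (Finset.mem_filter.1 hj).2
    rw [Pi.sub_apply, hp j i hj, hq j i hj]
  rw [hsub, hz] at hcard
  have hpos : ((Finset.univ.filter fun j => x j = x i).card : ℝ) ≠ 0 :=
    Nat.cast_ne_zero.2 (Finset.card_ne_zero_of_mem (a := i) (by simp))
  exact hi (sub_eq_zero.1 ((mul_eq_zero.1 hcard.symm).resolve_left hpos))

/-! ### The Bottom-Heavy rule -/

lemma bottomHeavy_eq_of_eq {n : ℕ} (x : Fin n → ℝ) (i j : Fin n) (hij : x i = x j) :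
    bottomHeavy n x i = bottomHeavy n x j := by
  have herase : ∑ k ∈ Finset.univ.erase i, x k = ∑ k ∈ Finset.univ.erase j, x k := by
    have hi := Finset.sum_erase_add _ x (Finset.mem_univ i)
    have hj := Finset.sum_erase_add _ x (Finset.mem_univ j)
    linarith
  simp only [bottomHeavy, Finset.mem_filter, Finset.mem_univ, true_and, hij, herase]

lemma bottomHeavy_of_exists_eq_zero {n : ℕ} {x : Fin n → ℝ} {i₀ : Fin n} (h₀ : x i₀ = 0)
    (i : Fin n) : bottomHeavy n x i =
      if x i = 0 then ((Finset.univ.filter fun j : Fin n => x j = 0).card : ℝ)⁻¹ else 0 := by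
  rw [bottomHeavy, if_neg fun h => (h i₀).ne' h₀]

lemma sum_bottomHeavy_of_exists_eq_zero {n : ℕ} {x : Fin n → ℝ} {i₀ : Fin n} (h₀ : x i₀ = 0) :
    ∑ i with x i = 0, bottomHeavy n x i = 1 := by
  rw [Finset.sum_congr rfl fun i hi => (bottomHeavy_of_exists_eq_zero h₀ i).trans
    (if_pos (Finset.mem_filter.1 hi).2), Finset.sum_const, nsmul_eq_mul]
  exact mul_inv_cancel₀ (Nat.cast_ne_zero.2 (Finset.card_ne_zero_of_mem (a := i₀) (by simp [h₀])))

/-- At a positive profile, the Bottom-Heavy rule distributes the whole bad, and every lower set of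
agents receives either its total cap or the whole bad. -/
lemma bottomHeavy_of_pos {n : ℕ} (hn : 2 ≤ n) {x : Fin n → ℝ} (hx : ∀ i, 0 < x i) :
    ∑ i, bottomHeavy n x i = 1 ∧
    ∀ c, ∑ j with x j ≤ c, bottomHeavy n x j = 1 ∨
      ∑ j with x j ≤ c, bottomHeavy n x j = ∑ j with x j ≤ c, cap x j := by
  let sorted : Fin n → ℝ := fun k => x (Tuple.sort x k)
  let low : ℕ → Finset (Fin n) := fun t =>
    Finset.univ.filter fun j => ∃ k : Fin n, (k : ℕ) < t ∧ x j ≤ sorted k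
  let tt : ℕ := Nat.findGreatest (fun t => ∑ j ∈ low t, cap x j ≤ 1) n
  have hφ (i : Fin n) : bottomHeavy n x i =
      if i ∈ low tt then cap x i
      else if htt : tt < n then
        if x i = sorted ⟨tt, htt⟩ then
          (1 - ∑ j ∈ low tt, cap x j) /
            ((Finset.univ.filter fun j => x j = sorted ⟨tt, htt⟩).card : ℝ)
        else 0
      else 0 := by
    rw [bottomHeavy, if_pos hx]
    rfl
  have hlow_mem (t : ℕ) (j : Fin n) :
      j ∈ low t ↔ ∃ k : Fin n, (k : ℕ) < t ∧ x j ≤ sorted k := by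
    simp [low]
  have hmono : Monotone sorted := Tuple.monotone_sort x
  have hsorted (j : Fin n) : sorted ((Tuple.sort x).symm j) = x j := by simp [sorted]
  have hlow_le : ∑ j ∈ low tt, cap x j ≤ 1 :=
    Nat.findGreatest_spec (P := fun t => ∑ j ∈ low t, cap x j ≤ 1) (m := 0) (Nat.zero_le n)
      (by simp [low])
  have hcapped (c : ℝ) (hc : (Finset.univ.filter fun j => x j ≤ c) ⊆ low tt) :
      ∑ j with x j ≤ c, bottomHeavy n x j = ∑ j with x j ≤ c, cap x j :=
    Finset.sum_congr rfl fun j hj => by rw [hφ, if_pos (hc hj)]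
  by_cases htt : tt < n
  · have htt_notMem (i : Fin n) (hi : x i = sorted ⟨tt, htt⟩) : i ∉ low tt := by
      intro hmem
      obtain ⟨k, hk, hik⟩ := (hlow_mem tt i).1 hmem
      have heq : low (tt + 1) = low tt := by
        ext j
        rw [hlow_mem, hlow_mem]
        constructor
        · rintro ⟨l, hl, hjl⟩
          have hl' : l ≤ ⟨tt, htt⟩ := by rw [Fin.le_def]; exact Nat.lt_succ_iff.1 hl
          exact ⟨k, hk, hjl.trans ((hmono hl').trans (hi ▸ hik))⟩
        · rintro ⟨l, hl, hjl⟩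
          exact ⟨l, hl.trans (Nat.lt_succ_self _), hjl⟩
      exact Nat.findGreatest_is_greatest (P := fun t => ∑ j ∈ low t, cap x j ≤ 1)
        (Nat.lt_succ_self tt) htt (by rw [Nat.succ_eq_add_one, heq]; exact hlow_le)
    set C := Finset.univ.filter fun j => x j = sorted ⟨tt, htt⟩ with hC
    have hdisj : Disjoint (low tt) C := Finset.disjoint_right.2 fun i hi =>
      htt_notMem i (Finset.mem_filter.1 hi).2
    have hCcard : (C.card : ℝ) ≠ 0 := Nat.cast_ne_zero.2
      (Finset.card_ne_zero_of_mem (a := Tuple.sort x ⟨tt, htt⟩) (by simp [hC, sorted]))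
    have hunion : ∑ i ∈ low tt ∪ C, bottomHeavy n x i = 1 := by
      rw [Finset.sum_union hdisj, Finset.sum_congr rfl fun i hi => (hφ i).trans (if_pos hi),
        Finset.sum_congr (s₁ := C) rfl fun i hi => (hφ i).trans <|
          (if_neg (Finset.disjoint_right.1 hdisj hi)).trans <| (dif_pos htt).trans
            (if_pos (Finset.mem_filter.1 hi).2),
        Finset.sum_const, nsmul_eq_mul, mul_div_cancel₀ _ hCcard]
      ring
    have hzero (i : Fin n) (hi : i ∉ low tt ∪ C) : bottomHeavy n x i = 0 := by
      rw [Finset.mem_union, not_or] at hi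
      rw [hφ, if_neg hi.1, dif_pos htt, if_neg fun h => hi.2 (by simp [hC, h])]
    have hfull (S : Finset (Fin n)) (hS : low tt ∪ C ⊆ S) : ∑ i ∈ S, bottomHeavy n x i = 1 := by
      rw [← hunion]
      exact (Finset.sum_subset hS fun i _ hi => hzero i hi).symm
    refine ⟨hfull _ (Finset.subset_univ _), fun c => ?_⟩
    by_cases hc : (Finset.univ.filter fun j => x j ≤ c) ⊆ low tt
    · exact Or.inr (hcapped c hc)
    · obtain ⟨j, hj, hjlow⟩ := Finset.not_subset.1 hc
      have hjc : x j ≤ c := (Finset.mem_filter.1 hj).2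
      have hgt (k : Fin n) (hk : (k : ℕ) < tt) : sorted k < x j := by
        by_contra hle
        exact hjlow ((hlow_mem tt j).2 ⟨k, hk, not_lt.1 hle⟩)
      refine Or.inl (hfull _ fun i hi => Finset.mem_filter.2 ⟨Finset.mem_univ i, ?_⟩)
      rcases Finset.mem_union.1 hi with hi | hi
      · obtain ⟨k, hk, hik⟩ := (hlow_mem tt i).1 hi
        exact hik.trans ((hgt k hk).le.trans hjc)
      · rw [(Finset.mem_filter.1 hi).2]
        refine le_trans ?_ hjc
        rw [← hsorted j]
        refine hmono (Fin.le_def.2 (not_lt.1 fun hlt => ?_))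
        exact (hgt _ hlt).ne (hsorted j)
  · have hlow_univ : low tt = Finset.univ := by
      refine Finset.eq_univ_of_forall fun j => (hlow_mem tt j).2
        ⟨(Tuple.sort x).symm j, ?_, (hsorted j).ge⟩
      exact lt_of_lt_of_le (Fin.is_lt _) (not_lt.1 htt)
    refine ⟨?_, fun c => Or.inr (hcapped c ((Finset.subset_univ _).trans_eq hlow_univ.symm))⟩
    obtain ⟨M, hM⟩ := (Set.finite_range x).bddAbove
    have hall : (Finset.univ.filter fun j => x j ≤ M) = Finset.univ :=
      Finset.filter_true_of_mem fun j _ => hM ⟨j, rfl⟩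
    have hge := card_le_mul_sum_cap hn hx M
    have heq := hcapped M ((Finset.subset_univ _).trans_eq hlow_univ.symm)
    rw [hall] at hge heq
    rw [hlow_univ] at hlow_le
    rw [heq]
    refine hlow_le.antisymm ?_
    rw [Finset.card_univ, Fintype.card_fin] at hge
    have hn0 : (0 : ℝ) < n := by positivity
    exact le_of_mul_le_mul_left (by rwa [mul_one]) hn0

lemma sum_bottomHeavy {n : ℕ} (hn : 2 ≤ n) {x : Fin n → ℝ} (hx : NonnegVec x) :
    ∑ i, bottomHeavy n x i = 1 := by
  by_cases hpos : ∀ i, 0 < x i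
  · exact (bottomHeavy_of_pos hn hpos).1
  · push Not at hpos
    obtain ⟨i₀, hi₀⟩ := hpos
    have h₀ : x i₀ = 0 := hi₀.antisymm (hx i₀)
    rw [← sum_bottomHeavy_of_exists_eq_zero h₀]
    refine (Finset.sum_subset (Finset.subset_univ _) fun i _ hi => ?_).symm
    rw [bottomHeavy_of_exists_eq_zero h₀, if_neg (by simpa using hi)]

/-- Every lower set of agents receives at least as much of the bad under the Bottom-Heavy rule as
under any symmetric rule satisfying Fair Share. -/
lemma sum_le_sum_bottomHeavy {n : ℕ} (hn : 2 ≤ n) {ψ : (Fin n → ℝ) → (Fin n → ℝ)}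
    (hrule : IsRule ψ) (hsym : IsSymmetricRule ψ) (hfs : FairShareBad ψ)
    {x : Fin n → ℝ} (hx : NonnegVec x) (c : ℝ) :
    ∑ j with x j ≤ c, ψ x j ≤ ∑ j with x j ≤ c, bottomHeavy n x j := by
  have hle_one : ∑ j with x j ≤ c, ψ x j ≤ 1 := by
    rw [← (hrule.2 x hx).2]
    exact Finset.sum_le_sum_of_subset_of_nonneg (Finset.subset_univ _)
      fun i _ _ => (hrule.2 x hx).1 i
  by_cases hpos : ∀ i, 0 < x i
  · rcases (bottomHeavy_of_pos hn hpos).2 c with h | h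
    · rwa [h]
    · rw [h]
      exact sum_le_sum_cap hn hrule hsym hfs hpos _ (card_le_mul_sum_cap hn hpos c)
  · push Not at hpos
    obtain ⟨i₀, hi₀⟩ := hpos
    have h₀ : x i₀ = 0 := hi₀.antisymm (hx i₀)
    rcases lt_or_ge c 0 with hc | hc
    · rw [Finset.filter_false_of_mem fun j _ => not_le.2 (hc.trans_le (hx j))]
      simp
    · refine hle_one.trans_eq ?_
      rw [← sum_bottomHeavy_of_exists_eq_zero h₀]
      refine Finset.sum_subset (fun i hi => ?_) fun i _ hi => ?_
      · simp only [Finset.mem_filter, Finset.mem_univ, true_and] at hi ⊢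
        exact hi.trans_le hc
      · rw [bottomHeavy_of_exists_eq_zero h₀, if_neg (by simpa using hi)]

/-- Theorem 2, for bads: for every `n ≥ 2`, the Bottom-Heavy rule `φ¹`
dominates every other symmetric measurable division rule satisfying Fair Share
for a bad: if `ψ` differs from `φ¹` somewhere on `[0,∞)ⁿ`, then the ex-post
cost of `φ¹` is at most that of `ψ` at every profile, and strictly smaller at
some profile. -/
theorem bottom_heavy_dominates
    (n : ℕ) (hn : 2 ≤ n) (ψ : (Fin n → ℝ) → (Fin n → ℝ))
    (hrule : IsRule ψ) (hsym : IsSymmetricRule ψ) (hfs : FairShareBad ψ)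
    (hne : ∃ x, NonnegVec x ∧ ψ x ≠ bottomHeavy n x) :
    (∀ x, NonnegVec x →
      ∑ i, bottomHeavy n x i * x i ≤ ∑ i, ψ x i * x i) ∧
    (∃ x, NonnegVec x ∧
      ∑ i, bottomHeavy n x i * x i < ∑ i, ψ x i * x i) := by
  have hcost (x : Fin n → ℝ) (hx : NonnegVec x) :=
    cost_le_of_dominance x (bottomHeavy n x) (ψ x)
      ((sum_bottomHeavy hn hx).trans (hrule.2 x hx).2.symm)
      (sum_le_sum_bottomHeavy hn hrule hsym hfs hx)
      (bottomHeavy_eq_of_eq x) (fun _ _ => hsym.eq_of_eq hx)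
  refine ⟨fun x hx => (hcost x hx).1, ?_⟩
  obtain ⟨x, hx, hneq⟩ := hne
  exact ⟨x, hx, (hcost x hx).1.lt_of_ne fun h => hneq ((hcost x hx).2 h).symm⟩

end PaperFD
end
end

section
/- The Competitive Ratio of the Proportional rule for a good equals (√n + 1)/2: for every integer n ≥ 2, sup over x ∈ [0,∞)ⁿ, x ≠ 0, of (max_i x_i)·(∑_i x_i) / (∑_i x_i²) = (√n + 1)/2. -/
open MeasureTheory
open scoped BigOperators ENNReal

noncomputable section

namespace PaperFD

/-- With `x k` in the role of the maximum: the ratio bound `(√n + 1)/2`, in product form. -/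
theorem two_mul_coord_mul_sum_le {n : ℕ} (x : Fin n → ℝ) (k : Fin n) :
    2 * (x k * ∑ i, x i) ≤ (√n + 1) * ∑ i, x i ^ 2 := by
  have hs : 0 < √(n : ℝ) + 1 := by positivity
  have hsq : √(n : ℝ) ^ 2 = n := Real.sq_sqrt n.cast_nonneg
  have hle : ∑ i, 2 * (√n + 1) * x k * x i ≤
      ∑ i, ((√n + 1) ^ 2 * x i ^ 2 + x k ^ 2 - if i = k then (n : ℝ) * x k ^ 2 else 0) := by
    refine Finset.sum_le_sum fun i _ => ?_
    split_ifs with h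
    · subst h
      linear_combination (-(x i ^ 2)) * hsq
    · nlinarith [sq_nonneg ((√n + 1) * x i - x k)]
  simp only [Finset.sum_sub_distrib, Finset.sum_add_distrib, ← Finset.mul_sum,
    Finset.sum_ite_eq', Finset.mem_univ, if_true, Finset.sum_const, Finset.card_univ,
    Fintype.card_fin, nsmul_eq_mul] at hle
  refine le_of_mul_le_mul_left ?_ hs
  linarith

/-- The profile with one coordinate `√n + 1` and all others `1` attains the ratio `(√n + 1)/2`. -/
theorem ratio_update_one {n : ℕ} (k : Fin n) :
    (⨆ i, Function.update (1 : Fin n → ℝ) k (√n + 1) i) *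
        (∑ i, Function.update (1 : Fin n → ℝ) k (√n + 1) i) /
        (∑ i, Function.update (1 : Fin n → ℝ) k (√n + 1) i ^ 2) = (√n + 1) / 2 := by
  have : Nonempty (Fin n) := ⟨k⟩
  have hn : (0 : ℝ) < n := by exact_mod_cast k.pos
  have hs : 0 < √(n : ℝ) := Real.sqrt_pos.2 hn
  have hsq : √(n : ℝ) ^ 2 = n := Real.sq_sqrt hn.le
  have hmax : (⨆ i, Function.update (1 : Fin n → ℝ) k (√n + 1) i) = √n + 1 := by
    refine le_antisymm (ciSup_le fun i => ?_) ?_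
    · rcases eq_or_ne i k with rfl | h
      · simp
      · simp [h]
    · simpa using le_ciSup
        (Set.finite_range (Function.update (1 : Fin n → ℝ) k (√n + 1))).bddAbove k
  have hsum (p : ℕ) : ∑ i, Function.update (1 : Fin n → ℝ) k (√n + 1) i ^ p =
      (√n + 1) ^ p + (n - 1) := by
    have hterm (i : Fin n) : Function.update (1 : Fin n → ℝ) k (√n + 1) i ^ p =
        1 + if i = k then (√n + 1) ^ p - 1 else 0 := by
      rcases eq_or_ne i k with rfl | h
      · simp
      · simp [h]
    simp only [hterm, Finset.sum_add_distrib, Finset.sum_ite_eq', Finset.mem_univ, if_true,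
      Finset.sum_const, Finset.card_univ, Fintype.card_fin, nsmul_eq_mul]
    ring
  have hsum_one := hsum 1
  simp only [pow_one] at hsum_one
  rw [hmax, hsum_one, hsum 2, ← hsq, Real.sqrt_sq hs.le, div_eq_div_iff (by nlinarith) two_ne_zero]
  ring

/-- Proposition 4 (ii): the Competitive Ratio of the Proportional rule for a
good equals `(√n + 1)/2`:
`sup_{x ≥ 0, x ≠ 0} (max_i x_i)·(∑_i x_i)/(∑_i x_i²) = (√n + 1)/2`. -/
theorem proportional_competitive_ratio_good
    (n : ℕ) (hn : 2 ≤ n) :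
    (⨆ x : {x : Fin n → ℝ // NonnegVec x ∧ x ≠ 0},
        (⨆ i, x.1 i) * (∑ i, x.1 i) / (∑ i, (x.1 i) ^ 2))
      = (Real.sqrt n + 1) / 2 := by
  have : Nonempty (Fin n) := ⟨⟨0, by omega⟩⟩
  have hub (x : {x : Fin n → ℝ // NonnegVec x ∧ x ≠ 0}) :
      (⨆ i, x.1 i) * (∑ i, x.1 i) / (∑ i, (x.1 i) ^ 2) ≤ (√n + 1) / 2 := by
    obtain ⟨x, -, hne⟩ := x
    obtain ⟨k, hk⟩ := exists_eq_ciSup_of_finite (f := x)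
    obtain ⟨j, hj⟩ := Function.ne_iff.1 hne
    have hpos : 0 < ∑ i, x i ^ 2 :=
      Finset.sum_pos' (fun i _ => sq_nonneg _) ⟨j, Finset.mem_univ j, sq_pos_iff.2 hj⟩
    rw [← hk, div_le_iff₀ hpos]
    linarith [two_mul_coord_mul_sum_le x k]
  have k : Fin n := ⟨0, by omega⟩
  have hnonneg : NonnegVec (Function.update (1 : Fin n → ℝ) k (√n + 1)) := fun i => by
    rcases eq_or_ne i k with rfl | h
    · simp only [Function.update_self]
      positivity
    · simp [h]
  have hne : Function.update (1 : Fin n → ℝ) k (√n + 1) ≠ 0 := fun h => by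
    have hk := congrFun h k
    simp only [Function.update_self, Pi.zero_apply] at hk
    linarith [Real.sqrt_nonneg (n : ℝ)]
  have : Nonempty {x : Fin n → ℝ // NonnegVec x ∧ x ≠ 0} := ⟨_, hnonneg, hne⟩
  refine le_antisymm (ciSup_le hub) ?_
  rw [← ratio_update_one k]
  exact le_ciSup (f := fun x : {x : Fin n → ℝ // NonnegVec x ∧ x ≠ 0} =>
    (⨆ i, x.1 i) * (∑ i, x.1 i) / (∑ i, (x.1 i) ^ 2))
    ⟨_, Set.forall_mem_range.2 hub⟩ ⟨_, hnonneg, hne⟩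

end PaperFD
end
end

section
/- Lower bound on the Price of Fairness of any fair rule for a good: fix n ≥ 2 and an integer m with 1 ≤ m ≤ n−1, and consider the normalized problem P(n,m) with m equally likely states, where in state k (1 ≤ k ≤ m) agent k has utility m, agents i ≤ m with i ≠ k have utility 0, and agents i > m have utility 1. Then every family of allocations ψ¹,…,ψ^m ∈ Δ(N) satisfying Fair Share in P(n,m) — i.e., (1/m)·∑_{k=1}^m ψ^k_i·x^k_i ≥ 1/n for every agent i, where x^k is the utility profile in state k — has expected welfare (1/m)·∑_{k=1}^m ∑_i ψ^k_i·x^k_i ≤ m²/n − m/n + 1. Since E[max_i X_i] = m in P(n,m), and since for every n ≥ 2 there exists an integer m ∈ [1, n−1] with m/(m²/n − m/n + 1) ≥ n/(2√n − 1/2), every rule satisfying Fair Share has Price of Fairness at least n/(2√n − 1/2). -/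
open MeasureTheory
open scoped BigOperators ENNReal

noncomputable section

namespace PaperFD

/-- The utility profile of the problem `P(n,m)`: in state `k` (of `m` equally
likely states), agent `k` has utility `m`, the other agents `i < m` have
utility `0`, and the agents `i ≥ m` have utility `1`. -/
def profileP (n m : ℕ) (k : Fin m) (i : Fin n) : ℝ :=
  if (i : ℕ) = (k : ℕ) then (m : ℝ) else if (i : ℕ) < m then 0 else 1

lemma profileP_nonneg (n m : ℕ) (k : Fin m) : NonnegVec (profileP n m k) := by
  intro i
  unfold profileP
  split_ifs <;> positivity

/-- Welfare in state `k` trades off the shares of the agents `i ≥ m`, who are worth `1`,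
against those of the agents `i < m`, who are worth at most `m`. -/
lemma mul_profileP_le {n m : ℕ} (k : Fin m) (i : Fin n) {p : ℝ} (hp : 0 ≤ p) :
    p * profileP n m k i ≤ (m : ℝ) * p - ((m : ℝ) - 1) * (if m ≤ (i : ℕ) then p else 0) := by
  have hk := k.isLt
  have hmp : 0 ≤ (m : ℝ) * p := by positivity
  unfold profileP
  split_ifs <;> first | omega | linarith

/-- Every allocation satisfying Fair Share in `P(n,m)` has welfare at most
`m²/n − m/n + 1`. -/
lemma welfare_le_of_fairShare {n m : ℕ} (hm1 : 1 ≤ m) (hmn : m ≤ n)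
    (ψ : Fin m → Fin n → ℝ) (hψ : ∀ k, (∀ i, 0 ≤ ψ k i) ∧ ∑ i, ψ k i = 1)
    (hfair : ∀ i : Fin n, (1 : ℝ) / n ≤ (1 / (m : ℝ)) * ∑ k, ψ k i * profileP n m k i) :
    (1 / (m : ℝ)) * ∑ k, ∑ i, ψ k i * profileP n m k i
      ≤ (m : ℝ) ^ 2 / n - (m : ℝ) / n + 1 := by
  have hm : (1 : ℝ) ≤ m := by exact_mod_cast hm1
  have hn : (0 : ℝ) < n := by exact_mod_cast (show 0 < n by omega)
  set S : ℝ := (1 / (m : ℝ)) * ∑ k, ∑ i : Fin n, (if m ≤ (i : ℕ) then ψ k i else 0) with hS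
  have hcard : ∑ i : Fin n, (if m ≤ (i : ℕ) then (1 : ℝ) / n else 0) = ((n : ℝ) - m) / n := by
    rw [Fin.sum_univ_eq_sum_range (fun j => if m ≤ j then (1 : ℝ) / n else 0) n,
      ← Finset.sum_range_add_sum_Ico _ hmn,
      Finset.sum_eq_zero (fun j hj => if_neg (by simpa using hj)),
      Finset.sum_congr rfl (fun j hj => if_pos (Finset.mem_Ico.mp hj).1)]
    simp [Nat.cast_sub hmn, div_eq_mul_inv]
  have hSge : ((n : ℝ) - m) / n ≤ S := by
    rw [← hcard, hS, Finset.sum_comm, Finset.mul_sum]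
    refine Finset.sum_le_sum fun i _ => ?_
    split_ifs with hi
    · refine (hfair i).trans_eq ?_
      congr 1
      refine Finset.sum_congr rfl fun k _ => ?_
      have hk := k.isLt
      rw [profileP, if_neg (by omega), if_neg (by omega), mul_one]
    · simp
  have hle : (1 / (m : ℝ)) * ∑ k, ∑ i, ψ k i * profileP n m k i ≤ m - ((m : ℝ) - 1) * S := by
    calc (1 / (m : ℝ)) * ∑ k, ∑ i, ψ k i * profileP n m k i
        ≤ (1 / (m : ℝ)) * ∑ k, ∑ i : Fin n, ((m : ℝ) * ψ k i
            - ((m : ℝ) - 1) * (if m ≤ (i : ℕ) then ψ k i else 0)) := by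
          gcongr with k _ i _
          exact mul_profileP_le k i ((hψ k).1 i)
      _ = m - ((m : ℝ) - 1) * S := by
          simp only [Finset.sum_sub_distrib, ← Finset.mul_sum, (hψ _).2, hS]
          simp
          field_simp
  calc (1 / (m : ℝ)) * ∑ k, ∑ i, ψ k i * profileP n m k i
      ≤ m - ((m : ℝ) - 1) * S := hle
    _ ≤ m - ((m : ℝ) - 1) * (((n : ℝ) - m) / n) := by
        gcongr
    _ = (m : ℝ) ^ 2 / n - (m : ℝ) / n + 1 := by
        field_simp
        ring

lemma welfareBound_pos {n m : ℕ} (hm1 : 1 ≤ m) :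
    0 < (m : ℝ) ^ 2 / n - (m : ℝ) / n + 1 := by
  have hm : (1 : ℝ) ≤ m := by exact_mod_cast hm1
  have : (m : ℝ) / n ≤ (m : ℝ) ^ 2 / n := by
    gcongr
    nlinarith
  linarith

/-- Rounding `√n` to the nearest integer gives a good choice of `m`. -/
lemma exists_ratio_ge {n : ℕ} (hn : 2 ≤ n) :
    ∃ m : ℕ, 1 ≤ m ∧ m ≤ n - 1 ∧
      (n : ℝ) / (2 * Real.sqrt n - 1 / 2)
        ≤ (m : ℝ) / ((m : ℝ) ^ 2 / n - (m : ℝ) / n + 1) := by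
  have hn' : (2 : ℝ) ≤ n := by exact_mod_cast hn
  set s := Real.sqrt n
  have hss : s ^ 2 = n := Real.sq_sqrt (by positivity)
  have hs : 1.4 ≤ s := Real.le_sqrt_of_sq_le (by norm_num; linarith)
  set m := ⌊s + 1 / 2⌋₊
  have hm1 : 1 ≤ m := Nat.le_floor (by norm_num; linarith)
  have hlo : (m : ℝ) ≤ s + 1 / 2 := Nat.floor_le (by linarith)
  have hhi : s + 1 / 2 < m + 1 := Nat.lt_floor_add_one _
  have hmn : m < n := by
    have : (m : ℝ) < n := by nlinarith
    exact_mod_cast this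
  have hm1' : (1 : ℝ) ≤ m := by exact_mod_cast hm1
  refine ⟨m, hm1, by omega, ?_⟩
  rw [div_le_div_iff₀ (by linarith) (welfareBound_pos hm1)]
  have : (n : ℝ) * ((m : ℝ) ^ 2 / n - (m : ℝ) / n + 1) = (m : ℝ) ^ 2 - m + n := by
    field_simp
  rw [this]
  nlinarith

/-- The problem `P(n,m)` as the uniform measure on its `m` states. -/
def problemP (n m : ℕ) : Measure (Fin n → ℝ) :=
  (m : ℝ≥0∞)⁻¹ • ∑ k : Fin m, Measure.dirac (profileP n m k)

lemma integrable_problemP {n m : ℕ} (hm1 : 1 ≤ m) (f : (Fin n → ℝ) → ℝ) :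
    Integrable f (problemP n m) := by
  refine Integrable.smul_measure ?_ (by simp; omega)
  exact integrable_finsetSum_measure.2 fun k _ => integrable_dirac (by simp)

lemma integral_problemP {n m : ℕ} (f : (Fin n → ℝ) → ℝ) :
    ∫ x, f x ∂(problemP n m) = (1 / (m : ℝ)) * ∑ k, f (profileP n m k) := by
  rw [problemP, integral_smul_measure,
    integral_finsetSum_measure fun k _ => integrable_dirac (by simp)]
  simp

lemma isNormalizedProblem_problemP {n m : ℕ} (hm1 : 1 ≤ m) :
    IsNormalizedProblem (problemP n m) := by
  have hm : (m : ℝ) ≠ 0 := by exact_mod_cast (show m ≠ 0 by omega)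
  refine ⟨⟨?_⟩, ?_, fun i => ⟨integrable_problemP hm1 _, ?_⟩⟩
  · simp only [problemP, Measure.smul_apply, Measure.finsetSum_apply, measure_univ, smul_eq_mul,
      Finset.sum_const, Finset.card_univ, Fintype.card_fin, nsmul_eq_mul, mul_one]
    exact ENNReal.inv_mul_cancel (by simp; omega) (by simp)
  · refine Measure.ae_smul_measure ?_ _
    rw [← Measure.sum_fintype, Measure.ae_sum_iff]
    intro k
    rw [ae_dirac_eq]
    exact profileP_nonneg n m k
  · rw [integral_problemP]
    suffices h : ∑ k : Fin m, profileP n m k i = m by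
      rw [h]
      field_simp
    by_cases hi : (i : ℕ) < m
    · rw [Finset.sum_eq_single (⟨i, hi⟩ : Fin m)]
      · simp [profileP]
      · intro k _ hk
        have : (i : ℕ) ≠ k := fun h => hk (Fin.ext h.symm)
        simp [profileP, this, hi]
      · simp
    · have hone : ∀ k : Fin m, profileP n m k i = 1 := by
        intro k
        have hk := k.isLt
        rw [profileP, if_neg (by omega), if_neg hi]
      simp [hone]

lemma iSup_profileP {n m : ℕ} (hmn : m ≤ n) (k : Fin m) :
    ⨆ i, profileP n m k i = m := by
  have hk := k.isLt
  have hm : (1 : ℝ) ≤ m := by exact_mod_cast (show 1 ≤ m by omega)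
  have : Nonempty (Fin n) := ⟨⟨k, by omega⟩⟩
  apply le_antisymm
  · refine ciSup_le fun i => ?_
    unfold profileP
    split_ifs <;> linarith
  · refine le_ciSup_of_le (Set.finite_range _).bddAbove (⟨k, by omega⟩ : Fin n) ?_
    simp [profileP]

/-- Proposition 4 (iv), lower bound on the Price of Fairness for a good: in the
normalized problem `P(n,m)`, every family of allocations satisfying Fair Share
has expected welfare at most `m²/n − m/n + 1`; there is an integer
`m' ∈ [1, n−1]` with `m'/(m'²/n − m'/n + 1) ≥ n/(2√n − 1/2)`; consequently
every symmetric measurable fair rule has Price of Fairness at least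
`n/(2√n − 1/2)` (witnessed by some normalized problem, on which the optimal
utilitarian welfare is at least `n/(2√n − 1/2)` times the rule's welfare). -/
theorem price_of_fairness_lower_bound_good
    (n m : ℕ) (hn : 2 ≤ n) (hm1 : 1 ≤ m) (hm2 : m ≤ n - 1) :
    (∀ ψ : Fin m → Fin n → ℝ,
      (∀ k, (∀ i, 0 ≤ ψ k i) ∧ ∑ i, ψ k i = 1) →
      (∀ i : Fin n, (1 : ℝ) / n ≤ (1 / (m : ℝ)) * ∑ k, ψ k i * profileP n m k i) →
      (1 / (m : ℝ)) * ∑ k, ∑ i, ψ k i * profileP n m k i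
        ≤ (m : ℝ) ^ 2 / n - (m : ℝ) / n + 1) ∧
    (∃ m' : ℕ, 1 ≤ m' ∧ m' ≤ n - 1 ∧
      (n : ℝ) / (2 * Real.sqrt n - 1 / 2)
        ≤ (m' : ℝ) / ((m' : ℝ) ^ 2 / n - (m' : ℝ) / n + 1)) ∧
    (∀ φ : (Fin n → ℝ) → (Fin n → ℝ),
      IsRule φ → IsSymmetricRule φ → FairShareGood φ →
      ∃ μ : Measure (Fin n → ℝ), IsNormalizedProblem μ ∧
        ((n : ℝ) / (2 * Real.sqrt n - 1 / 2)) * ∫ x, ∑ i, φ x i * x i ∂μ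
          ≤ ∫ x, ⨆ i, x i ∂μ) := by
  obtain ⟨m', hm1', hm2', hratio⟩ := exists_ratio_ge hn
  refine ⟨welfare_le_of_fairShare hm1 (by omega), ⟨m', hm1', hm2', hratio⟩, ?_⟩
  intro φ hφ _ hfair
  have hnorm := isNormalizedProblem_problemP (n := n) hm1'
  refine ⟨problemP n m', hnorm, ?_⟩
  have hwelfare := welfare_le_of_fairShare hm1' (show m' ≤ n by omega)
    (fun k => φ (profileP n m' k)) (fun k => hφ.2 _ (profileP_nonneg n m' k))
    (fun i => (hfair _ hnorm i).trans_eq (integral_problemP _))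
  have hsqrt : (1 : ℝ) ≤ Real.sqrt n :=
    Real.one_le_sqrt.2 (by exact_mod_cast (show 1 ≤ n by omega))
  have hm' : (m' : ℝ) ≠ 0 := by exact_mod_cast (show m' ≠ 0 by omega)
  have hmax : ∫ x, ⨆ i, x i ∂(problemP n m') = m' := by
    rw [integral_problemP]
    simp [iSup_profileP (show m' ≤ n by omega), hm']
  rw [hmax, integral_problemP]
  refine (mul_le_mul_of_nonneg_left hwelfare
    (div_nonneg (by positivity) (by linarith))).trans ?_
  rwa [← le_div_iff₀ (welfareBound_pos hm1')]

end PaperFD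
end
end

section
/- Upper bound step for the optimal Price of Fairness for a bad: let n ≥ 2 and let x ∈ [0,∞)ⁿ with 0 < x₁ + … + xₙ ≤ 1. Then there exist λ ∈ [0,1] and τ ∈ Δ(N) such that the vector y = λ·x + (1−λ)·τ satisfies y_i ≤ 1/n for every i and y₁ + … + yₙ ≤ (n/4 + 1/2 + 1/(4n))·(x₁ + … + xₙ). Consequently, for every normalized problem for a bad there is a Fair-Share-feasible expected disutility profile with total cost at most (n/4 + 1/2 + 1/(4n)) times the optimal unconstrained cost E[min_i X_i]. -/
noncomputable section

namespace PaperFD17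

/-- If `0 ≤ l`, `l * x i ≤ 1 / n` for all `i`, `∑ x ≤ 1` and `l * ∑ x < 1`, then
the remaining mass `1 - l` can be distributed within the capacities `1 / n - l * x i`. -/
lemma exists_simplex_le_residual {n : ℕ} (hn : n ≠ 0) {x : Fin n → ℝ} {l : ℝ} (hl : 0 ≤ l)
    (hx : ∑ i, x i ≤ 1) (hlx : ∀ i, l * x i ≤ 1 / (n : ℝ)) (hlt : l * ∑ i, x i < 1) :
    ∃ τ : Fin n → ℝ, (∀ i, 0 ≤ τ i) ∧ ∑ i, τ i = 1 ∧
      ∀ i, l * x i + (1 - l) * τ i ≤ 1 / (n : ℝ) := by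
  have hpos : 0 < 1 - l * ∑ i, x i := by linarith
  have hcap : ∑ i, (1 / (n : ℝ) - l * x i) = 1 - l * ∑ i, x i := by
    rw [Finset.sum_sub_distrib, ← Finset.mul_sum]
    simp [hn]
  refine ⟨fun i => (1 / (n : ℝ) - l * x i) / (1 - l * ∑ j, x j),
    fun i => div_nonneg (sub_nonneg.2 (hlx i)) hpos.le, ?_, fun i => ?_⟩
  · rw [← Finset.sum_div, hcap, div_self hpos.ne']
  · have hle : (1 - l) * ((1 / (n : ℝ) - l * x i) / (1 - l * ∑ j, x j))
        ≤ 1 / (n : ℝ) - l * x i := by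
      rw [← mul_div_assoc, div_le_iff₀ hpos, mul_comm]
      exact mul_le_mul_of_nonneg_left
        (sub_le_sub_left (mul_le_of_le_one_right hl hx) 1) (sub_nonneg.2 (hlx i))
    linarith

/-- The quadratic estimate behind the bound on the price of fairness. -/
lemma one_sub_div_add_le_mul {a s : ℝ} (ha : 0 < a) (hs : 0 < s) :
    1 / a + (1 - 1 / (a * s)) ≤ (a / 4 + 1 / 2 + 1 / (4 * a)) * s := by
  have h : (a / 4 + 1 / 2 + 1 / (4 * a)) * s - (1 / a + (1 - 1 / (a * s)))
      = ((a + 1) * s / 2 - 1) ^ 2 / (a * s) := by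
    field_simp
    ring
  have : 0 ≤ ((a + 1) * s / 2 - 1) ^ 2 / (a * s) := by positivity
  linarith

lemma one_le_price {a : ℝ} (ha : 0 < a) : 1 ≤ a / 4 + 1 / 2 + 1 / (4 * a) := by
  have h : a / 4 + 1 / 2 + 1 / (4 * a) - 1 = (a - 1) ^ 2 / (4 * a) := by
    field_simp
    ring
  have : 0 ≤ (a - 1) ^ 2 / (4 * a) := by positivity
  linarith

/-- Mixing `x` with a suitable point of the simplex yields a Fair Share profile of bounded cost. -/
lemma exists_fair_mixture {n : ℕ} (hn : 2 ≤ n) {x : Fin n → ℝ} (hx : ∀ i, 0 ≤ x i)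
    (hpos : 0 < ∑ i, x i) (hle : ∑ i, x i ≤ 1) :
    ∃ (l : ℝ) (τ : Fin n → ℝ), 0 ≤ l ∧ l ≤ 1 ∧
      (∀ i, 0 ≤ τ i) ∧ (∑ i, τ i = 1) ∧
      (∀ i, l * x i + (1 - l) * τ i ≤ 1 / (n : ℝ)) ∧
      (∑ i, (l * x i + (1 - l) * τ i))
        ≤ ((n : ℝ) / 4 + 1 / 2 + 1 / (4 * n)) * ∑ i, x i := by
  have hn0 : n ≠ 0 := by omega
  have hnpos : (0 : ℝ) < n := by positivity
  have hninv : 1 / (n : ℝ) < 1 := by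
    rw [div_lt_one hnpos]
    exact_mod_cast hn
  have hxle : ∀ i, x i ≤ ∑ j, x j := fun i =>
    Finset.single_le_sum (fun j _ => hx j) (Finset.mem_univ i)
  have hsum : ∀ (l : ℝ) (τ : Fin n → ℝ), ∑ i, τ i = 1 →
      ∑ i, (l * x i + (1 - l) * τ i) = l * ∑ i, x i + (1 - l) := fun l τ hτ => by
    rw [Finset.sum_add_distrib, ← Finset.mul_sum, ← Finset.mul_sum, hτ, mul_one]
  rcases le_total (∑ i, x i) (1 / (n : ℝ)) with hs | hs
  · obtain ⟨τ, hτ, hτ1, hfair⟩ := exists_simplex_le_residual hn0 zero_le_one hle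
      (fun i => by linarith [hxle i]) (by linarith)
    refine ⟨1, τ, zero_le_one, le_rfl, hτ, hτ1, hfair, ?_⟩
    rw [hsum _ _ hτ1, sub_self, add_zero]
    exact mul_le_mul_of_nonneg_right (one_le_price hnpos) hpos.le
  · have hl : 0 ≤ 1 / ((n : ℝ) * ∑ i, x i) := by positivity
    have hls : 1 / ((n : ℝ) * ∑ i, x i) * ∑ i, x i = 1 / (n : ℝ) := by field_simp
    obtain ⟨τ, hτ, hτ1, hfair⟩ := exists_simplex_le_residual hn0 hl hle
      (fun i => hls ▸ mul_le_mul_of_nonneg_left (hxle i) hl) (hls ▸ hninv)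
    refine ⟨_, τ, hl, ?_, hτ, hτ1, hfair, ?_⟩
    · rw [div_le_one (by positivity)]
      rwa [div_le_iff₀' hnpos] at hs
    · rw [hsum _ _ hτ1, hls]
      exact one_sub_div_add_le_mul hnpos hpos

/-- Step 2 of Proposition 5 (iii), upper bound on the optimal Price of Fairness
for a bad: for any `x ∈ [0,∞)ⁿ` with `0 < ∑ x_i ≤ 1` there are `λ ∈ [0,1]` and
`τ` in the simplex such that `y = λx + (1−λ)τ` satisfies `y_i ≤ 1/n` for every
`i` (Fair Share) and `∑ y_i ≤ (n/4 + 1/2 + 1/(4n))·∑ x_i`.  Consequently, for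
any convex set `C` of achievable expected-disutility profiles containing the
simplex (as in a normalized problem for a bad) and any cost-minimizing
achievable `x ∈ C` with `0 < ∑ x_i ≤ 1`, there is a Fair-Share-feasible
profile `y ∈ C` of total cost at most `(n/4 + 1/2 + 1/(4n))·∑ x_i`. -/
theorem fair_profile_with_bounded_cost
    (n : ℕ) (hn : 2 ≤ n) :
    (∀ x : Fin n → ℝ, (∀ i, 0 ≤ x i) → 0 < ∑ i, x i → ∑ i, x i ≤ 1 →
      ∃ (l : ℝ) (τ : Fin n → ℝ), 0 ≤ l ∧ l ≤ 1 ∧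
        (∀ i, 0 ≤ τ i) ∧ (∑ i, τ i = 1) ∧
        (∀ i, l * x i + (1 - l) * τ i ≤ 1 / (n : ℝ)) ∧
        (∑ i, (l * x i + (1 - l) * τ i))
          ≤ ((n : ℝ) / 4 + 1 / 2 + 1 / (4 * n)) * ∑ i, x i) ∧
    (∀ C : Set (Fin n → ℝ), Convex ℝ C →
      {p : Fin n → ℝ | (∀ i, 0 ≤ p i) ∧ ∑ i, p i = 1} ⊆ C →
      ∀ x ∈ C, (∀ i, 0 ≤ x i) → 0 < ∑ i, x i → ∑ i, x i ≤ 1 →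
        ∃ y ∈ C, (∀ i, y i ≤ 1 / (n : ℝ)) ∧
          ∑ i, y i ≤ ((n : ℝ) / 4 + 1 / 2 + 1 / (4 * n)) * ∑ i, x i) := by
  refine ⟨fun x => exists_fair_mixture hn, fun C hC hΔ x hxC hx hpos hle => ?_⟩
  obtain ⟨l, τ, hl, hl1, hτ, hτ1, hfair, hcost⟩ := exists_fair_mixture hn hx hpos hle
  exact ⟨l • x + (1 - l) • τ, hC hxC (hΔ ⟨hτ, hτ1⟩) hl (sub_nonneg.2 hl1) (by ring),
    hfair, hcost⟩

end PaperFD17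
end
end

section
/- Bounds underlying the limiting ratio of the Top-Heavy rule (Lemma 2): let X be a nonnegative random variable with E[X] = 1 and E[|X − 1|] = D (X integrable). Then, with the convention that max(2 − 1/X, 0) = 0 when X = 0, one has D²/(2D + 4) ≤ E[X − max(2 − 1/X, 0)] ≤ D. Consequently, when D > 0, the quantity 1/(1 − E[max(2 − 1/X, 0)]) — which equals the limiting welfare ratio π(φ¹, P_∞(ν)) of the Top-Heavy rule φ¹ for i.i.d. utilities with unbounded-support distribution ν — lies between 1/D and 2/D + 4/D². -/
open MeasureTheory

noncomputable section

/-- The share `max (2 - 1 / x) 0`, set to `0` at `x = 0`. -/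
def topHeavyShare (x : ℝ) : ℝ := if x = 0 then 0 else max (2 - 1 / x) 0

lemma topHeavyShare_of_half_le {x : ℝ} (hx : 1 / 2 ≤ x) : topHeavyShare x = 2 - 1 / x := by
  have h0 : 0 < x := by linarith
  have h : 1 / x ≤ 2 := by rw [div_le_iff₀ h0]; linarith
  rw [topHeavyShare, if_neg h0.ne', max_eq_left (by linarith)]

lemma topHeavyShare_of_lt_half {x : ℝ} (h0 : 0 ≤ x) (hx : x < 1 / 2) : topHeavyShare x = 0 := by
  rcases h0.eq_or_lt with rfl | h0
  · simp [topHeavyShare]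
  · have h : 2 ≤ 1 / x := by rw [le_div_iff₀ h0]; linarith
    rw [topHeavyShare, if_neg h0.ne', max_eq_right (by linarith)]

lemma measurable_topHeavyShare : Measurable topHeavyShare := by
  unfold topHeavyShare
  exact Measurable.ite (measurableSet_singleton 0) measurable_const (by fun_prop)

lemma abs_topHeavyShare_le {x : ℝ} (h0 : 0 ≤ x) : |topHeavyShare x| ≤ 2 := by
  have : 0 ≤ 1 / x := by positivity
  unfold topHeavyShare
  split_ifs
  · simp
  · rw [abs_of_nonneg (le_max_right _ _)]
    exact max_le (by linarith) (by norm_num)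

lemma sub_topHeavyShare_le {x : ℝ} (h0 : 0 ≤ x) : x - topHeavyShare x ≤ |x - 1| := by
  rcases lt_or_ge x (1 / 2) with hx | hx
  · rw [topHeavyShare_of_lt_half h0 hx]
    linarith [neg_le_abs (x - 1)]
  · have hpos : 0 < x := by linarith
    rw [topHeavyShare_of_half_le hx]
    rcases le_total x 1 with h1 | h1
    · have : 1 / x ≤ 3 - 2 * x := by rw [div_le_iff₀ hpos]; nlinarith
      linarith [neg_le_abs (x - 1)]
    · have : 1 / x ≤ 1 := by rw [div_le_iff₀ hpos]; linarith
      linarith [le_abs_self (x - 1)]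

/-- `x - topHeavyShare x` dominates the tangent line of the convex function `t ↦ t ^ 2 / (1 + t)`
at `t = 1 / c - 1`, evaluated at the positive part of `x - 1`. -/
lemma tangent_le_sub_topHeavyShare {x : ℝ} (c : ℝ) (h0 : 0 ≤ x) :
    (1 - c ^ 2) * ((|x - 1| + (x - 1)) / 2) - (1 - c) ^ 2 ≤ x - topHeavyShare x := by
  rcases le_total x 1 with h1 | h1
  · rw [abs_of_nonpos (by linarith)]
    have : 0 ≤ x - topHeavyShare x := by
      rcases lt_or_ge x (1 / 2) with hx | hx
      · rwa [topHeavyShare_of_lt_half h0 hx, sub_zero]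
      · have : 2 - x ≤ 1 / x := by
          rw [le_div_iff₀ (by linarith)]; nlinarith [sq_nonneg (x - 1)]
        rw [topHeavyShare_of_half_le hx]; linarith
    nlinarith [sq_nonneg (1 - c)]
  · rw [abs_of_nonneg (by linarith), topHeavyShare_of_half_le (by linarith)]
    have : 2 * c - c ^ 2 * x ≤ 1 / x := by
      rw [le_div_iff₀ (by linarith)]; nlinarith [sq_nonneg (c * x - 1)]
    nlinarith

/-- Lemma 2 (bounds behind the limiting ratio of the Top-Heavy rule): if `X ≥ 0`
is an integrable random variable with `E[X] = 1` and average absolute deviation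
`D = E[|X − 1|]`, then `D²/(2D + 4) ≤ E[X − max(2 − 1/X, 0)] ≤ D` (with the
convention that `max(2 − 1/X, 0) = 0` when `X = 0`); consequently, when
`D > 0`, the limiting welfare ratio `1/(1 − E[max(2 − 1/X, 0)])` of the
Top-Heavy rule `φ¹` lies between `1/D` and `2/D + 4/D²`. -/
theorem top_heavy_limit_ratio_bounds
    {Ω : Type*} [MeasurableSpace Ω] (P : Measure Ω) [IsProbabilityMeasure P]
    (X : Ω → ℝ) (hXmeas : Measurable X) (hXpos : ∀ᵐ ω ∂P, 0 ≤ X ω)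
    (hXint : Integrable X P) (hXmean : ∫ ω, X ω ∂P = 1)
    (D : ℝ) (hD : D = ∫ ω, |X ω - 1| ∂P) :
    (D ^ 2 / (2 * D + 4)
        ≤ ∫ ω, (X ω - if X ω = 0 then 0 else max (2 - 1 / X ω) 0) ∂P ∧
      ∫ ω, (X ω - if X ω = 0 then 0 else max (2 - 1 / X ω) 0) ∂P ≤ D) ∧
    (0 < D →
      1 / D ≤ 1 / (1 - ∫ ω, (if X ω = 0 then 0 else max (2 - 1 / X ω) 0) ∂P) ∧
      1 / (1 - ∫ ω, (if X ω = 0 then 0 else max (2 - 1 / X ω) 0) ∂P)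
        ≤ 2 / D + 4 / D ^ 2) := by
  have hshare : ∀ ω, (if X ω = 0 then 0 else max (2 - 1 / X ω) 0) = topHeavyShare (X ω) :=
    fun _ => rfl
  simp only [hshare]
  have hdev : Integrable (fun ω => X ω - 1) P := hXint.sub (integrable_const 1)
  have habs : Integrable (fun ω => |X ω - 1|) P := hdev.abs
  have hint : Integrable (fun ω => topHeavyShare (X ω)) P :=
    Integrable.of_bound (measurable_topHeavyShare.comp hXmeas).aestronglyMeasurable 2
      (hXpos.mono fun ω h => abs_topHeavyShare_le h)
  have hsub : Integrable (fun ω => X ω - topHeavyShare (X ω)) P := hXint.sub hint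
  have hD0 : 0 ≤ D := hD ▸ integral_nonneg fun ω => abs_nonneg _
  have hupper : ∫ ω, (X ω - topHeavyShare (X ω)) ∂P ≤ D := by
    rw [hD]
    exact integral_mono_ae hsub habs (hXpos.mono fun ω h => sub_topHeavyShare_le h)
  have hlower : D ^ 2 / (2 * D + 4) ≤ ∫ ω, (X ω - topHeavyShare (X ω)) ∂P := by
    have hpos : Integrable
        (fun ω => (1 - (2 / (D + 2)) ^ 2) * ((|X ω - 1| + (X ω - 1)) / 2)) P :=
      ((habs.add hdev).div_const 2).const_mul _
    refine le_trans (le_of_eq ?_) (integral_mono_ae (hpos.sub (integrable_const _)) hsub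
      (hXpos.mono fun ω h => tangent_le_sub_topHeavyShare (2 / (D + 2)) h))
    simp only [Pi.sub_apply]
    rw [integral_sub hpos (integrable_const _), integral_const_mul, integral_div,
      integral_add habs hdev, integral_sub hXint (integrable_const 1), ← hD, hXmean]
    simp only [integral_const, probReal_univ, one_smul]
    field_simp
    ring
  refine ⟨⟨hlower, hupper⟩, fun hDpos => ?_⟩
  have hbound : 0 < D ^ 2 / (2 * D + 4) := by positivity
  rw [integral_sub hXint hint, hXmean] at hlower hupper
  refine ⟨one_div_le_one_div_of_le (hbound.trans_le hlower) hupper,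
    (one_div_le_one_div_of_le hbound hlower).trans_eq ?_⟩
  field_simp
end
end
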